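/- (Existence of a half-domain where the linearized quadratic form is nonnegative.) Let Ω be an open ball or annulus centered at the origin in ℝ^N, N ≥ 2, and let U ∈ C²(Ω;ℝ^m) ∩ C(Ω̄;ℝ^m) be a classical solution of −Δu_i = f_i(|x|,U) in Ω, u_i = 0 on ∂Ω, with Morse index μ(U) ≤ N, and assume the system is fully coupled along U in Ω(e) for every e ∈ S^{N−1}. Then there exists a direction e ∈ S^{N−1} such that Q_U(Ψ; Ω(e)) ≥ 0 for every Ψ ∈ C^1_c(Ω(e);ℝ^m); equivalently, the first symmetric eigenvalue of the linearized operator L_U V = −ΔV − J_F(|x|,U)V in Ω(e) is nonnegative. -/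

import Mathlib

open MeasureTheory Real Set
open scoped RealInnerProductSpace ENNReal

noncomputable section

/-- Euclidean space `ℝ^N`. -/
abbrev EuclN (N : ℕ) := EuclideanSpace ℝ (Fin N)

/-- The Laplacian of a scalar function on `ℝ^N`. -/
def lap {N : ℕ} (u : EuclN N → ℝ) (x : EuclN N) : ℝ :=
  ∑ i : Fin N, iteratedFDeriv ℝ 2 u x ![EuclideanSpace.single i 1, EuclideanSpace.single i 1]

/-- Partial derivative `∂f/∂u_j` of `f(r, u)` with respect to the `j`-th `u`-variable. -/
def pd {m : ℕ} (f : ℝ → (Fin m → ℝ) → ℝ) (j : Fin m) (r : ℝ) (s : Fin m → ℝ) : ℝ :=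
  fderiv ℝ (f r) s (Pi.single j 1)

/-- `Ψ ∈ C^1_c(Ω'; ℝ^m)`. -/
def IsTestFun {N m : ℕ} (Ω' : Set (EuclN N)) (Ψ : Fin m → EuclN N → ℝ) : Prop :=
  ∀ i, ContDiff ℝ 1 (Ψ i) ∧ HasCompactSupport (Ψ i) ∧ tsupport (Ψ i) ⊆ Ω'

/-- The quadratic form `Q_U(Ψ; Ω')` of the linearized operator at a solution `U`. -/
def Qform {N m : ℕ} (f : Fin m → ℝ → (Fin m → ℝ) → ℝ) (U : Fin m → EuclN N → ℝ)
    (Ω' : Set (EuclN N)) (Ψ : Fin m → EuclN N → ℝ) : ℝ :=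
  ∫ x in Ω', ((∑ i, ‖gradient (Ψ i) x‖ ^ 2) -
    ∑ i, ∑ j, pd (f i) j ‖x‖ (fun k => U k x) * Ψ i x * Ψ j x)

/-- There is a `k`-dimensional subspace of `C^1_c(Ω'; ℝ^m)` on which `Q_U(·; Ω')`
is negative definite. -/
def NegDefFamily {N m : ℕ} (f : Fin m → ℝ → (Fin m → ℝ) → ℝ) (U : Fin m → EuclN N → ℝ)
    (Ω' : Set (EuclN N)) (k : ℕ) : Prop :=
  ∃ Ψ : Fin k → Fin m → EuclN N → ℝ,
    (∀ l, IsTestFun Ω' (Ψ l)) ∧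
    ∀ c : Fin k → ℝ, c ≠ 0 → Qform f U Ω' (fun i x => ∑ l, c l * Ψ l i x) < 0

/-- The semilinear system is cooperative (weakly coupled) in `Ω'`. -/
def CoopAlong {N m : ℕ} (f : Fin m → ℝ → (Fin m → ℝ) → ℝ) (Ω' : Set (EuclN N)) : Prop :=
  ∀ i j, i ≠ j → ∀ x ∈ Ω', ∀ s : Fin m → ℝ, 0 ≤ pd (f i) j ‖x‖ s

/-- The semilinear system is fully coupled along the solution `U` in `Ω'`. -/
def FullyCoupledAlong {N m : ℕ} (f : Fin m → ℝ → (Fin m → ℝ) → ℝ)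
    (U : Fin m → EuclN N → ℝ) (Ω' : Set (EuclN N)) : Prop :=
  CoopAlong f Ω' ∧
  ∀ I J : Finset (Fin m), I.Nonempty → J.Nonempty → Disjoint I J → I ∪ J = Finset.univ →
    ∃ i₀ ∈ I, ∃ j₀ ∈ J,
      0 < volume {x ∈ Ω' | 0 < pd (f i₀) j₀ ‖x‖ (fun k => U k x)}

/-- `Ω` is an open ball or annulus centered at the origin. -/
def IsBallOrAnnulus {N : ℕ} (Ω : Set (EuclN N)) : Prop :=
  (∃ R : ℝ, 0 < R ∧ Ω = Metric.ball (0 : EuclN N) R) ∨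
  (∃ r R : ℝ, 0 < r ∧ r < R ∧ Ω = {x : EuclN N | r < ‖x‖ ∧ ‖x‖ < R})

/-- The half-domain `Ω(e) = {x ∈ Ω : x·e > 0}`. -/
def halfDom {N : ℕ} (Ω : Set (EuclN N)) (e : EuclN N) : Set (EuclN N) :=
  {x ∈ Ω | 0 < ⟪x, e⟫}

/-- Reflection through the hyperplane `T(e) = {x : x·e = 0}`. -/
def reflPt {N : ℕ} (e x : EuclN N) : EuclN N := x - (2 * ⟪x, e⟫) • e

/-- `U` is foliated Schwarz symmetric on `Ω` with respect to the axis `p`. -/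
def FoliatedSchwarzWith {N m : ℕ} (Ω : Set (EuclN N)) (U : Fin m → EuclN N → ℝ)
    (p : EuclN N) : Prop :=
  ‖p‖ = 1 ∧ ∀ i, ∀ x ∈ Ω, ∀ y ∈ Ω, ‖x‖ = ‖y‖ → ⟪y, p⟫ ≤ ⟪x, p⟫ → U i y ≤ U i x

/-- `U` is foliated Schwarz symmetric on `Ω`. -/
def FoliatedSchwarz {N m : ℕ} (Ω : Set (EuclN N)) (U : Fin m → EuclN N → ℝ) : Prop :=
  ∃ p : EuclN N, FoliatedSchwarzWith Ω U p

/-- `U` is radial on `Ω`. -/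
def IsRadial {N m : ℕ} (Ω : Set (EuclN N)) (U : Fin m → EuclN N → ℝ) : Prop :=
  ∀ i, ∀ x ∈ Ω, ∀ y ∈ Ω, ‖x‖ = ‖y‖ → U i x = U i y

/-- `U` is a classical solution of `-Δu_i = f_i(|x|, U)` in `Ω`, `u_i = 0` on `∂Ω`. -/
def IsSolution {N m : ℕ} (Ω : Set (EuclN N)) (f : Fin m → ℝ → (Fin m → ℝ) → ℝ)
    (U : Fin m → EuclN N → ℝ) : Prop :=
  (∀ i, ∀ x ∈ Ω, -lap (U i) x = f i ‖x‖ (fun k => U k x)) ∧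
  (∀ i, ∀ x ∈ frontier Ω, U i x = 0)

/-- The bilinear form of the linear system `-ΔU + C(x) U`. -/
def BformL {N m : ℕ} (Ω' : Set (EuclN N)) (C : Fin m → Fin m → EuclN N → ℝ)
    (V Φ : Fin m → EuclN N → ℝ) : ℝ :=
  ∫ x in Ω', ((∑ i, ⟪gradient (V i) x, gradient (Φ i) x⟫) +
    ∑ i, ∑ j, C i j x * V i x * Φ j x)

/-- `-ΔU + D U ≥ 0` weakly in `Ω'`. -/
def WeakSuperSol {N m : ℕ} (Ω' : Set (EuclN N)) (D : Fin m → Fin m → EuclN N → ℝ)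
    (U : Fin m → EuclN N → ℝ) : Prop :=
  ∀ Ψ : Fin m → EuclN N → ℝ, IsTestFun Ω' Ψ → (∀ i x, 0 ≤ Ψ i x) →
    0 ≤ BformL Ω' D U Ψ

/-- `-ΔU + D U ≤ 0` weakly in `Ω'`. -/
def WeakSubSol {N m : ℕ} (Ω' : Set (EuclN N)) (D : Fin m → Fin m → EuclN N → ℝ)
    (U : Fin m → EuclN N → ℝ) : Prop :=
  ∀ Ψ : Fin m → EuclN N → ℝ, IsTestFun Ω' Ψ → (∀ i x, 0 ≤ Ψ i x) →
    BformL Ω' D U Ψ ≤ 0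

/-- The linear system with matrix `D` is cooperative in `Ω`: `d_ij ≤ 0` a.e. for `i ≠ j`. -/
def LinCoop {N m : ℕ} (Ω : Set (EuclN N)) (D : Fin m → Fin m → EuclN N → ℝ) : Prop :=
  ∀ i j, i ≠ j → ∀ᵐ x ∂(volume : Measure (EuclN N)), x ∈ Ω → D i j x ≤ 0

/-- The linear system with matrix `D` is fully coupled in `Ω`. -/
def LinFullyCoupled {N m : ℕ} (Ω : Set (EuclN N)) (D : Fin m → Fin m → EuclN N → ℝ) : Prop :=
  LinCoop Ω D ∧
  ∀ I J : Finset (Fin m), I.Nonempty → J.Nonempty → Disjoint I J → I ∪ J = Finset.univ →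
    ∃ i₀ ∈ I, ∃ j₀ ∈ J, 0 < volume {x ∈ Ω | D i₀ j₀ x < 0}

/-- First symmetric eigenvalue on `Ω'`: the infimum of the Rayleigh quotient of the
symmetric matrix `C` over nontrivial test functions. -/
def lamOneSym {N m : ℕ} (Ω' : Set (EuclN N)) (C : Fin m → Fin m → EuclN N → ℝ) : ℝ :=
  sInf {r : ℝ | ∃ Ψ : Fin m → EuclN N → ℝ, IsTestFun Ω' Ψ ∧ (∃ i x, Ψ i x ≠ 0) ∧
    r = BformL Ω' C Ψ Ψ / ∫ x in Ω', ∑ i, (Ψ i x) ^ 2}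

end

section BU

abbrev Chn (X : Type*) := List X →₀ ZMod 2

noncomputable def cn {X : Type*} (x : X) : Chn X →ₗ[ZMod 2] Chn X :=
  Finsupp.lmapDomain _ _ (List.cons x)

noncomputable def bdL {X : Type*} : List X → Chn X
  | [] => 0
  | x :: t => Finsupp.single t 1 + cn x (bdL t)

noncomputable def bd {X : Type*} : Chn X →ₗ[ZMod 2] Chn X :=
  Finsupp.linearCombination (ZMod 2) bdL

noncomputable def ev {X : Type*} (φ : List X → ZMod 2) : Chn X →ₗ[ZMod 2] ZMod 2 :=
  Finsupp.linearCombination (ZMod 2) φ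

noncomputable def ngc {X : Type*} [Neg X] : Chn X →ₗ[ZMod 2] Chn X :=
  Finsupp.lmapDomain _ _ (List.map Neg.neg)

def wL {X : Type*} : List (X → ZMod 2) → List X → ZMod 2
  | [], [_] => 1
  | s :: ss, x :: y :: l => (s x + s y) * wL ss (y :: l)
  | _, _ => 0

def pL {X : Type*} (s : X → ZMod 2) (ss : List (X → ZMod 2)) : List X → ZMod 2
  | [] => 0
  | x :: l => s x * wL ss (x :: l)

@[simp] lemma cn_single {X : Type*} (x : X) (l : List X) (a : ZMod 2) :
    cn x (Finsupp.single l a) = Finsupp.single (x :: l) a := by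
  simp [cn]

@[simp] lemma ngc_single {X : Type*} [Neg X] (l : List X) (a : ZMod 2) :
    ngc (Finsupp.single l a) = Finsupp.single (l.map Neg.neg) a := by
  simp [ngc]

@[simp] lemma ev_single {X : Type*} (φ : List X → ZMod 2) (l : List X) :
    ev φ (Finsupp.single l 1) = φ l := by
  simp [ev]

@[simp] lemma bd_single {X : Type*} (l : List X) :
    bd (Finsupp.single l 1) = bdL l := by
  simp [bd]

lemma chn_ext {X : Type*} {M : Type*} [AddCommMonoid M] [Module (ZMod 2) M]
    {f g : Chn X →ₗ[ZMod 2] M}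
    (h : ∀ l, f (Finsupp.single l 1) = g (Finsupp.single l 1)) (c : Chn X) : f c = g c := by
  have : f = g := by
    apply Finsupp.lhom_ext'
    intro l
    apply LinearMap.ext_ring
    simpa using h l
  rw [this]

lemma z2 (a : ZMod 2) : a + a = 0 := CharTwo.add_self_eq_zero a

lemma chn2 {X : Type*} (c : Chn X) : c + c = 0 := by
  ext l; simp [z2]

lemma bd_cn {X : Type*} (x : X) (c : Chn X) : bd (cn x c) = c + cn x (bd c) := by
  have := chn_ext (f := bd ∘ₗ cn x) (g := LinearMap.id + cn x ∘ₗ bd)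
    (by intro l; simp [bdL]) c
  simpa using this

lemma bd_bdL {X : Type*} (l : List X) : bd (bdL l) = 0 := by
  induction l with
  | nil => simp [bdL]
  | cons x t ih => simp [bdL, bd_cn, ih, chn2]

lemma bd_bd {X : Type*} (c : Chn X) : bd (bd c) = 0 := by
  have := chn_ext (f := bd ∘ₗ bd) (g := (0 : Chn X →ₗ[ZMod 2] Chn X))
    (by intro l; simp [bd_bdL]) c
  simpa using this

lemma ngc_cn {X : Type*} [Neg X] (x : X) (c : Chn X) : ngc (cn x c) = cn (-x) (ngc c) := by
  have := chn_ext (f := ngc ∘ₗ cn x) (g := cn (-x) ∘ₗ ngc)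
    (by intro l; simp) c
  simpa using this

lemma ngc_bdL {X : Type*} [Neg X] (l : List X) : ngc (bdL l) = bdL (l.map Neg.neg) := by
  induction l with
  | nil => simp [bdL]
  | cons x t ih => simp [bdL, ngc_cn, ih]

lemma ngc_bd {X : Type*} [Neg X] (c : Chn X) : ngc (bd c) = bd (ngc c) := by
  have := chn_ext (f := ngc ∘ₗ bd) (g := bd ∘ₗ (ngc (X := X)))
    (by intro l; simp [ngc_bdL]) c
  simpa using this

lemma ngc_ngc {X : Type*} [InvolutiveNeg X] (c : Chn X) : ngc (ngc c) = c := by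
  have := chn_ext (f := ngc ∘ₗ ngc (X := X)) (g := LinearMap.id)
    (by intro l; simp ) c
  simpa using this

lemma wL_cons {X : Type*} (s : X → ZMod 2) (ss : List (X → ZMod 2)) (x : X) (t : List X) :
    wL (s :: ss) (x :: t) = s x * wL ss t + pL s ss t := by
  cases t with
  | nil => cases ss <;> simp [wL, pL]
  | cons y l => simp only [wL, pL]; ring

lemma ev_wL_cn {X : Type*} (s : X → ZMod 2) (ss : List (X → ZMod 2)) (x : X) (c : Chn X) :
    ev (wL (s :: ss)) (cn x c) = s x * ev (wL ss) c + ev (pL s ss) c := by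
  have := chn_ext (f := ev (wL (s :: ss)) ∘ₗ cn x) (g := s x • ev (wL ss) + ev (pL s ss))
    (by intro l; simp [wL_cons]) c
  simpa using this

lemma ev_pL_cn {X : Type*} (s : X → ZMod 2) (ss : List (X → ZMod 2)) (x : X) (c : Chn X) :
    ev (pL s ss) (cn x c) = s x * ev (wL ss) (cn x c) := by
  have := chn_ext (f := ev (pL s ss) ∘ₗ cn x) (g := s x • (ev (wL ss) ∘ₗ cn x))
    (by intro l; simp [pL]) c
  simpa using this

lemma ev_nil_bdL {X : Type*} (l : List X) : ev (wL []) (bdL l) = 0 := by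
  have key : ∀ (x : X) (c : Chn X), ev (wL []) (cn x c) = c [] := by
    intro x c
    have := chn_ext (f := ev (wL []) ∘ₗ cn x) (g := Finsupp.lapply [])
      (by intro l; cases l <;> simp [wL]) c
    simpa using this
  have key2 : ∀ (x : X) (c : Chn X), (cn x c) [] = 0 := by
    intro x c
    have := chn_ext (f := Finsupp.lapply [] ∘ₗ cn x) (g := (0 : Chn X →ₗ[ZMod 2] ZMod 2))
      (by intro l; simp) c
    simpa using this
  cases l with
  | nil => simp [bdL]
  | cons x t =>
    rw [bdL, map_add, key, ev_single]
    cases t with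
    | nil => simp [wL, bdL]
    | cons y u =>
      rw [bdL, Finsupp.add_apply, key2]
      cases u with
      | nil => simp [wL, z2]
      | cons => simp [wL]

lemma ev_pL_of {X : Type*} (s : X → ZMod 2) (ss : List (X → ZMod 2))
    (h : ∀ l : List X, ev (wL ss) (bdL l) = 0) (l : List X) :
    ev (pL s ss) (bdL l) = wL (s :: ss) l := by
  cases l with
  | nil => simp [bdL, wL]
  | cons x t =>
    have h1 := h (x :: t)
    rw [bdL, map_add, ev_single] at h1
    have h2 : ev (wL ss) (cn x (bdL t)) = wL ss t := by
      have := z2 (wL ss t)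
      linear_combination h1 - this
    rw [bdL, map_add, ev_single, ev_pL_cn, h2, wL_cons, add_comm]

lemma ev_wL_bdL {X : Type*} (ss : List (X → ZMod 2)) :
    ∀ l : List X, ev (wL ss) (bdL l) = 0 := by
  induction ss with
  | nil => exact ev_nil_bdL
  | cons s ss ih =>
    intro l
    cases l with
    | nil => simp [bdL]
    | cons x t =>
      rw [bdL, map_add, ev_single, ev_wL_cn, ih, ev_pL_of s ss ih]
      simp [z2]

lemma ev_pL_bd {X : Type*} (s : X → ZMod 2) (ss : List (X → ZMod 2)) (c : Chn X) :
    ev (pL s ss) (bd c) = ev (wL (s :: ss)) c := by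
  have := chn_ext (f := ev (pL s ss) ∘ₗ bd) (g := ev (wL (s :: ss)))
    (by intro l; simp [ev_pL_of s ss (ev_wL_bdL ss)]) c
  simpa using this

lemma wL_zero {X : Type*} (ss : List (X → ZMod 2)) :
    ∀ l : List X, (∃ s ∈ ss, ∀ x ∈ l, ∀ y ∈ l, s x = s y) → wL ss l = 0 := by
  induction ss with
  | nil => simp
  | cons s ss ih =>
    intro l h
    match l with
    | [] => simp [wL]
    | [x] => simp [wL]
    | x :: y :: l =>
      obtain ⟨s', hs', h⟩ := h
      rw [wL]
      rcases List.mem_cons.1 hs' with rfl | hs'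
      · rw [h x (by simp) y (by simp), z2, zero_mul]
      · rw [ih, mul_zero]
        exact ⟨s', hs', fun a ha b hb => h a (List.mem_cons_of_mem _ ha) b (List.mem_cons_of_mem _ hb)⟩

lemma wL_neg {X : Type*} [Neg X] (ss : List (X → ZMod 2)) :
    ∀ l : List X, (∀ s ∈ ss, ∀ x ∈ l, s (-x) = s x + 1) → wL ss (l.map Neg.neg) = wL ss l := by
  induction ss with
  | nil => intro l _; match l with
    | [] => simp
    | [x] => simp [wL]
    | x :: y :: l => simp [wL]
  | cons s ss ih =>
    intro l h
    match l with
    | [] => simp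
    | [x] => simp [wL]
    | x :: y :: l =>
      have := ih (y :: l) (fun s hs x hx => h s (List.mem_cons_of_mem _ hs) x (List.mem_cons_of_mem _ hx))
      simp only [List.map_cons] at this ⊢
      rw [wL, wL, this, h s (by simp) x (by simp), h s (by simp) y (by simp)]
      have := z2 1
      linear_combination (wL ss (y :: l)) * this

lemma pL_neg {X : Type*} [Neg X] (s : X → ZMod 2) (ss : List (X → ZMod 2)) (l : List X)
    (h : ∀ s' ∈ s :: ss, ∀ x ∈ l, s' (-x) = s' x + 1) :
    pL s ss l + pL s ss (l.map Neg.neg) = wL ss l := by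
  cases l with
  | nil => cases ss <;> simp [pL, wL]
  | cons x t =>
    have := wL_neg ss (x :: t) (fun s hs x hx => h s (List.mem_cons_of_mem _ hs) x hx)
    simp only [List.map_cons] at this ⊢
    rw [pL, pL, this, h s (by simp) x (by simp)]
    have := z2 (s x)
    linear_combination (wL ss (x :: t)) * this

lemma supp_map {X : Type*} {M : Type*} [AddCommMonoid M] [Module (ZMod 2) M]
    {S : Set (List X)} (T : Chn X →ₗ[ZMod 2] M) (p : Submodule (ZMod 2) M)
    (h : ∀ l ∈ S, T (Finsupp.single l 1) ∈ p) {c : Chn X}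
    (hc : c ∈ Finsupp.supported (ZMod 2) (ZMod 2) S) : T c ∈ p := by
  rw [Finsupp.supported_eq_span_single] at hc
  have : Submodule.span (ZMod 2) ((fun i => Finsupp.single i (1 : ZMod 2)) '' S) ≤ p.comap T := by
    rw [Submodule.span_le]
    rintro _ ⟨l, hl, rfl⟩
    exact h l hl
  exact this hc

lemma supp_eq {X : Type*} {M : Type*} [AddCommGroup M] [Module (ZMod 2) M]
    {S : Set (List X)} (T T' : Chn X →ₗ[ZMod 2] M)
    (h : ∀ l ∈ S, T (Finsupp.single l 1) = T' (Finsupp.single l 1)) {c : Chn X}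
    (hc : c ∈ Finsupp.supported (ZMod 2) (ZMod 2) S) : T c = T' c := by
  have := supp_map (T - T') ⊥ (S := S) (c := c) (by
    intro l hl; simp [h l hl]) hc
  simpa [sub_eq_zero] using this

lemma bdL_supp {X : Type*} (l : List X) :
    bdL l ∈ Finsupp.supported (ZMod 2) (ZMod 2)
      {l' : List X | l'.length + 1 = l.length ∧ ∀ x ∈ l', x ∈ l} := by
  induction l with
  | nil => simp [bdL]
  | cons x t ih =>
    rw [bdL]
    refine Submodule.add_mem _ ?_ ?_
    · apply Finsupp.single_mem_supported
      refine ⟨by simp, fun y hy => List.mem_cons_of_mem _ hy⟩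
    · refine supp_map _ _ ?_ ih
      rintro l' ⟨h1, h2⟩
      rw [cn_single]
      apply Finsupp.single_mem_supported
      refine ⟨by simp [h1], ?_⟩
      intro y hy
      rcases List.mem_cons.1 hy with rfl | hy
      · simp
      · exact List.mem_cons_of_mem _ (h2 y hy)

noncomputable def bary {X : Type*} [AddCommGroup X] [Module ℝ X] (l : List X) : X :=
  ((l.length : ℝ))⁻¹ • l.sum

noncomputable def sdN {X : Type*} [AddCommGroup X] [Module ℝ X] : ℕ → (Chn X →ₗ[ZMod 2] Chn X)
  | 0 => LinearMap.id
  | k + 1 => Finsupp.linearCombination (ZMod 2) (fun l => cn (bary l) (sdN k (bdL l)))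

lemma sdN_succ {X : Type*} [AddCommGroup X] [Module ℝ X] (k : ℕ) (l : List X) :
    sdN (k + 1) (Finsupp.single l 1) = cn (bary l) (sdN k (bdL l)) := by
  simp [sdN]

lemma bary_neg {X : Type*} [AddCommGroup X] [Module ℝ X] (l : List X) :
    bary (l.map Neg.neg) = - bary l := by
  have : (l.map Neg.neg).sum = - l.sum := by
    induction l with
    | nil => simp
    | cons x t ih => simp [ih]; abel
  simp [bary, this]

lemma sdN_ngc {X : Type*} [AddCommGroup X] [Module ℝ X] (k : ℕ) (c : Chn X) :
    sdN k (ngc c) = ngc (sdN k c) := by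
  induction k generalizing c with
  | zero => simp [sdN]
  | succ k ih =>
    have := chn_ext (f := sdN (k+1) ∘ₗ ngc (X := X)) (g := ngc ∘ₗ sdN (k+1))
      (by intro l; simp [sdN_succ, ngc_cn, bary_neg, ← ih, ngc_bdL]) c
    simpa using this

lemma bd_sdN {X : Type*} [AddCommGroup X] [Module ℝ X] (k : ℕ) (l : List X)
    (hl : l.length = k + 1) :
    bd (sdN (k+1) (Finsupp.single l 1)) = sdN k (bdL l) := by
  induction k generalizing l with
  | zero =>
    obtain ⟨x, rfl⟩ := List.length_eq_one_iff.1 hl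
    simp [sdN, bdL]
  | succ k ih =>
    rw [sdN_succ, bd_cn]
    have h0 : ∀ l' ∈ {l' : List X | l'.length + 1 = l.length ∧ ∀ x ∈ l', x ∈ l},
        (bd ∘ₗ sdN (k+1)) (Finsupp.single l' 1) = (sdN k ∘ₗ bd) (Finsupp.single l' 1) := by
      rintro l' ⟨h1, h2⟩
      rw [LinearMap.comp_apply, LinearMap.comp_apply, bd_single]
      exact ih l' (by omega)
    have := supp_eq (bd ∘ₗ sdN (k+1)) (sdN k ∘ₗ bd) h0 (bdL_supp l)
    rw [LinearMap.comp_apply, LinearMap.comp_apply, bd_bdL, map_zero] at this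
    rw [this, map_zero, add_zero]

lemma bary_mem {X : Type*} [NormedAddCommGroup X] [NormedSpace ℝ X] (l : List X)
    (hl : l ≠ []) {C : Set X} (hC : Convex ℝ C) (h : ∀ x ∈ l, x ∈ C) : bary l ∈ C := by
  have hpos : 0 < (l.length : ℝ) := by
    have := List.length_pos_iff.2 hl
    exact_mod_cast this
  have e : bary l = ∑ i : Fin l.length, ((l.length : ℝ))⁻¹ • l.get i := by
    rw [bary, ← Finset.smul_sum]
    congr 1
    conv_lhs => rw [← List.ofFn_get l]
    rw [List.sum_ofFn]
  rw [e]
  apply hC.sum_mem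
  · intros; positivity
  · simp; field_simp
  · intro i _; exact h _ (List.get_mem _ _)

lemma sum_dist {X : Type*} [NormedAddCommGroup X] [NormedSpace ℝ X] (v : X) (d : ℝ)
    (hd : 0 ≤ d) (l : List X) (h : ∀ x ∈ l, ‖x - v‖ ≤ d) :
    ‖l.sum - (l.length : ℝ) • v‖ ≤ l.length * d ∧
      (v ∈ l → ‖l.sum - (l.length : ℝ) • v‖ ≤ (l.length - 1) * d) := by
  induction l with
  | nil => simp
  | cons x t ih =>
    obtain ⟨i1, i2⟩ := ih (fun y hy => h y (List.mem_cons_of_mem _ hy))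
    have hx := h x (by simp)
    have e : (x :: t).sum - ((x :: t).length : ℝ) • v = (x - v) + (t.sum - (t.length : ℝ) • v) := by
      simp [add_smul]; abel
    rw [e]
    have tri := norm_add_le (x - v) (t.sum - (t.length : ℝ) • v)
    push_cast [List.length_cons]
    constructor
    · nlinarith
    · intro hv
      rcases List.mem_cons.1 hv with rfl | hv
      · simp only [sub_self, zero_add] ; nlinarith
      · have := i2 hv
        nlinarith

lemma bary_dist {X : Type*} [NormedAddCommGroup X] [NormedSpace ℝ X] (n : ℕ) (l : List X)
    (hn : l.length ≤ n + 1) (d : ℝ) (hd : 0 ≤ d)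
    (h : ∀ x ∈ l, ∀ y ∈ l, dist x y ≤ d) (x : X) (hx : x ∈ convexHull ℝ {y | y ∈ l}) :
    dist x (bary l) ≤ (n / (n + 1) : ℝ) * d := by
  have : convexHull ℝ {y | y ∈ l} ⊆ Metric.closedBall (bary l) ((n / (n + 1) : ℝ) * d) := by
    apply convexHull_min _ (convex_closedBall _ _)
    intro v hv
    change v ∈ l at hv
    have hl : l ≠ [] := List.ne_nil_of_mem hv
    have hpos : 1 ≤ (l.length : ℝ) := by
      have := List.length_pos_iff.2 hl
      exact_mod_cast this
    have h2 := (sum_dist v d hd l (fun x hx => by rw [← dist_eq_norm]; exact h x hx v hv)).2 hv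
    rw [Metric.mem_closedBall, dist_comm, dist_eq_norm]
    have e : bary l - v = ((l.length : ℝ))⁻¹ • (l.sum - (l.length : ℝ) • v) := by
      rw [bary, smul_sub, smul_smul, inv_mul_cancel₀ (by positivity), one_smul]
    rw [e, norm_smul, norm_inv, Real.norm_of_nonneg (by positivity)]
    have hn' : (l.length : ℝ) ≤ n + 1 := by exact_mod_cast hn
    calc ((l.length : ℝ))⁻¹ * ‖(l.sum - (l.length : ℝ) • v)‖
        ≤ ((l.length : ℝ))⁻¹ * ((l.length - 1) * d) := by gcongr
      _ = (((l.length : ℝ) - 1) / l.length) * d := by ring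
      _ ≤ (n / (n + 1) : ℝ) * d := by
        refine mul_le_mul_of_nonneg_right ?_ hd
        rw [div_le_div_iff₀ (by positivity) (by positivity)]
        nlinarith
  exact this hx

lemma sdN_supp {X : Type*} [NormedAddCommGroup X] [NormedSpace ℝ X] (n : ℕ) (d : ℝ) (hd : 0 ≤ d)
    (k : ℕ) (hk : k ≤ n + 1) (l : List X) (hl : l.length = k)
    (h : ∀ x ∈ l, ∀ y ∈ l, dist x y ≤ d) :
    sdN k (Finsupp.single l 1) ∈ Finsupp.supported (ZMod 2) (ZMod 2)
      {l' : List X | l'.length = k ∧ (∀ x ∈ l', x ∈ convexHull ℝ {y | y ∈ l}) ∧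
        ∀ x ∈ l', ∀ y ∈ l', dist x y ≤ (n / (n + 1) : ℝ) * d} := by
  induction k generalizing l with
  | zero =>
    obtain rfl := List.length_eq_zero_iff.1 hl
    simp only [sdN, LinearMap.id_apply]
    apply Finsupp.single_mem_supported
    simp
  | succ k ih =>
    rw [sdN_succ]
    have hne : l ≠ [] := by rintro rfl; simp at hl
    have hb : bary l ∈ convexHull ℝ {y | y ∈ l} :=
      bary_mem l hne (convex_convexHull _ _) (fun x hx => subset_convexHull ℝ {y | y ∈ l} hx)
    have hθ : 0 ≤ (n / (n + 1) : ℝ) * d := by positivity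
    refine supp_map (S := {l' : List X | l'.length = k ∧ (∀ x ∈ l', x ∈ convexHull ℝ {y | y ∈ l}) ∧
        ∀ x ∈ l', ∀ y ∈ l', dist x y ≤ (n / (n + 1) : ℝ) * d}) _ _ ?_ ?_
    · rintro l' ⟨h1, h2, h3⟩
      rw [cn_single]
      apply Finsupp.single_mem_supported
      refine ⟨by simp [h1], ?_, ?_⟩
      · intro x hx
        rcases List.mem_cons.1 hx with rfl | hx
        · exact hb
        · exact h2 x hx
      · have hd' := bary_dist n l (by omega) d hd h
        intro x hx y hy
        rcases List.mem_cons.1 hx with rfl | hx <;> rcases List.mem_cons.1 hy with rfl | hy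
        · simpa using hθ
        · rw [dist_comm]; exact hd' y (h2 y hy)
        · exact hd' x (h2 x hx)
        · exact h3 x hx y hy
    · refine supp_map _ _ ?_ (bdL_supp l)
      rintro l' ⟨h1, h2⟩
      have := ih (by omega) l' (by omega) (fun x hx y hy => h x (h2 x hx) y (h2 y hy))
      refine Finsupp.supported_mono ?_ this
      rintro l'' ⟨g1, g2, g3⟩
      exact ⟨g1, fun x hx => convexHull_mono (fun y hy => h2 y hy) (g2 x hx), g3⟩

noncomputable def ek (n k : ℕ) : Fin (n + 1) → ℝ := fun i => if i.val = k then 1 else 0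

noncomputable def hk (n : ℕ) : ℕ → Chn (Fin (n + 1) → ℝ)
  | 0 => Finsupp.single [ek n 0] 1
  | k + 1 => cn (ek n (k + 1)) (hk n k + ngc (hk n k))

lemma bd_hk (n k : ℕ) : bd (hk n (k + 1)) = hk n k + ngc (hk n k) := by
  rw [hk, bd_cn]
  have : bd (hk n k + ngc (hk n k)) = 0 := by
    induction k with
    | zero =>
      rw [map_add, ← ngc_bd]
      simp [hk, bdL, chn2]
    | succ k ih =>
      have h1 : bd (hk n (k + 1)) = hk n k + ngc (hk n k) := by
        rw [hk, bd_cn, ih, map_zero, add_zero]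
      rw [map_add, ← ngc_bd, h1, map_add, ngc_ngc, add_comm (ngc (hk n k)), chn2]
  rw [this, map_zero, add_zero]

def faceS (n : ℕ) (σ : Fin (n + 1) → ℝ) : Set (Fin (n + 1) → ℝ) :=
  {x | (∀ i, 0 ≤ σ i * x i) ∧ ∑ i, σ i * x i = 1}

lemma faceS_convex (n : ℕ) (σ : Fin (n + 1) → ℝ) : Convex ℝ (faceS n σ) := by
  rintro x ⟨h1, h2⟩ y ⟨h3, h4⟩ a b ha hb hab
  refine ⟨fun i => ?_, ?_⟩
  · have := h1 i
    have := h3 i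
    simp only [Pi.add_apply, Pi.smul_apply, smul_eq_mul]
    have : σ i * (a * x i + b * y i) = a * (σ i * x i) + b * (σ i * y i) := by ring
    rw [this]; positivity
  · have : ∀ i, σ i * (a • x + b • y) i = a * (σ i * x i) + b * (σ i * y i) := by
      intro i; simp; ring
    simp only [this, Finset.sum_add_distrib, ← Finset.mul_sum, h2, h4]; linarith

lemma faceS_abs {n : ℕ} {σ : Fin (n + 1) → ℝ} (hσ : ∀ i, σ i = 1 ∨ σ i = -1)
    {x : Fin (n + 1) → ℝ} (hx : x ∈ faceS n σ) : ∑ i, |x i| = 1 := by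
  rw [← hx.2]
  refine Finset.sum_congr rfl fun i _ => ?_
  have h := hx.1 i
  rcases hσ i with h1 | h1 <;> rw [h1] at h ⊢
  · rw [abs_of_nonneg (by linarith)]; ring
  · rw [abs_of_nonpos (by linarith)]; ring

def goodS (n k : ℕ) (d : ℝ) : Set (List (Fin (n + 1) → ℝ)) :=
  {l | l.length = k + 1 ∧ (∃ σ : Fin (n + 1) → ℝ, (∀ i, σ i = 1 ∨ σ i = -1) ∧
    ∀ x ∈ l, x ∈ faceS n σ) ∧ ∀ x ∈ l, ∀ y ∈ l, dist x y ≤ d}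

lemma hk_supp0 (n k : ℕ) (hk' : k ≤ n) : hk n k ∈ Finsupp.supported (ZMod 2) (ZMod 2)
    {l | l.length = k + 1 ∧ (∃ σ : Fin (n + 1) → ℝ, (∀ i, σ i = 1 ∨ σ i = -1) ∧
    ∀ x ∈ l, x ∈ faceS n σ ∧ ∀ i : Fin (n + 1), k < i.val → x i = 0)} := by
  induction k with
  | zero =>
    rw [hk]
    apply Finsupp.single_mem_supported
    refine ⟨rfl, fun _ => 1, fun _ => Or.inl rfl, ?_⟩
    intro x hx
    obtain rfl := List.mem_singleton.1 hx
    refine ⟨⟨fun i => ?_, ?_⟩, fun i hi => ?_⟩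
    · simp only [ek]; split_ifs <;> simp
    · simp only [ek, one_mul]
      rw [Finset.sum_eq_single (⟨0, by omega⟩ : Fin (n + 1))]
      · simp
      · intro b _ hb; rw [if_neg]; intro h; apply hb; ext; exact h
      · simp
    · simp only [ek]; rw [if_neg (by omega)]
  | succ k ih =>
    rw [hk]
    have ih := ih (by omega)
    have ih2 : hk n k + ngc (hk n k) ∈ Finsupp.supported (ZMod 2) (ZMod 2)
        {l | l.length = k + 1 ∧ (∃ σ : Fin (n + 1) → ℝ, (∀ i, σ i = 1 ∨ σ i = -1) ∧
          ∀ x ∈ l, x ∈ faceS n σ ∧ ∀ i : Fin (n + 1), k < i.val → x i = 0)} := by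
      refine Submodule.add_mem _ ih (supp_map _ _ ?_ ih)
      rintro l ⟨h1, σ, h2, h3⟩
      rw [ngc_single]
      apply Finsupp.single_mem_supported
      refine ⟨by simp [h1], -σ, fun i => ?_, fun x hx => ?_⟩
      · rcases h2 i with h | h <;> simp [h]
      · obtain ⟨y, hy, rfl⟩ := List.mem_map.1 hx
        obtain ⟨⟨a, b⟩, c⟩ := h3 y hy
        refine ⟨⟨fun i => ?_, ?_⟩, fun i hi => ?_⟩
        · simpa using a i
        · simpa using b
        · simpa using c i hi
    refine supp_map _ _ ?_ ih2
    rintro l ⟨h1, σ, h2, h3⟩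
    rw [cn_single]
    apply Finsupp.single_mem_supported
    refine ⟨by simp [h1], fun i => if i.val = k + 1 then 1 else σ i, fun i => ?_, fun x hx => ?_⟩
    · simp only; split_ifs
      · simp
      · exact h2 i
    · rcases List.mem_cons.1 hx with rfl | hx
      · refine ⟨⟨fun i => ?_, ?_⟩, fun i hi => ?_⟩
        · simp only [ek]; split_ifs <;> simp
        · simp only [ek]
          rw [Finset.sum_eq_single (⟨k + 1, by omega⟩ : Fin (n + 1))]
          · simp
          · intro b _ hb; rw [if_neg (c := b.val = k + 1) (t := (1:ℝ)) (e := 0), mul_zero]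
            intro h; apply hb; ext; exact h
          · simp
        · simp only [ek]; rw [if_neg (by omega)]
      · obtain ⟨⟨a, b⟩, c⟩ := h3 x hx
        have e : ∀ i : Fin (n + 1), (if i.val = k + 1 then 1 else σ i) * x i = σ i * x i := by
          intro i; split_ifs with h
          · rw [c i (by omega)]; simp
          · rfl
        refine ⟨⟨fun i => ?_, ?_⟩, fun i hi => c i (by omega)⟩
        · rw [e]; exact a i
        · simp only [e]; exact b

lemma hk_supp (n k : ℕ) (hk' : k ≤ n) :
    hk n k ∈ Finsupp.supported (ZMod 2) (ZMod 2) (goodS n k 2) := by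
  refine Finsupp.supported_mono ?_ (hk_supp0 n k hk')
  rintro l ⟨h1, σ, h2, h3⟩
  refine ⟨h1, ⟨σ, h2, fun x hx => (h3 x hx).1⟩, fun x hx y hy => ?_⟩
  have hn : ∀ x ∈ l, ‖x‖ ≤ 1 := by
    intro x hx
    rw [pi_norm_le_iff_of_nonneg (by norm_num)]
    intro i
    rw [← faceS_abs h2 (h3 x hx).1]
    exact Finset.single_le_sum (f := fun i => |x i|) (fun _ _ => abs_nonneg _) (Finset.mem_univ i)
  have := hn x hx
  have := hn y hy
  rw [dist_eq_norm]
  have := norm_sub_le x y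
  linarith

noncomputable def ck (n : ℕ) : ℕ → ℕ → Chn (Fin (n + 1) → ℝ)
  | 0, k => hk n k
  | r + 1, k => sdN (k + 1) (ck n r k)

lemma ck_supp (n r k : ℕ) (hk' : k ≤ n) :
    ck n r k ∈ Finsupp.supported (ZMod 2) (ZMod 2) (goodS n k ((n / (n + 1) : ℝ) ^ r * 2)) := by
  induction r with
  | zero => simpa [ck] using hk_supp n k hk'
  | succ r ih =>
    rw [ck]
    refine supp_map _ _ ?_ ih
    rintro l ⟨h1, ⟨σ, h2, h3⟩, h4⟩
    refine Finsupp.supported_mono ?_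
      (sdN_supp n _ (by positivity) (k + 1) (by omega) l h1 h4)
    rintro l' ⟨g1, g2, g3⟩
    refine ⟨g1, ⟨σ, h2, fun x hx => ?_⟩, fun x hx y hy => ?_⟩
    · exact convexHull_min (fun y hy => h3 y hy) (faceS_convex n σ) (g2 x hx)
    · refine (g3 x hx y hy).trans (le_of_eq ?_); ring

lemma bd_ck (n r k : ℕ) (hk' : k + 1 ≤ n) : bd (ck n r (k + 1)) = ck n r k + ngc (ck n r k) := by
  induction r with
  | zero => exact bd_hk n k
  | succ r ih =>
    rw [ck, ck]
    have h0 : ∀ l ∈ goodS n (k + 1) ((n / (n + 1) : ℝ) ^ r * 2),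
        (bd ∘ₗ sdN (k+1+1)) (Finsupp.single l 1) = (sdN (k+1) ∘ₗ bd) (Finsupp.single l 1) := by
      rintro l ⟨h1, -⟩
      rw [LinearMap.comp_apply, LinearMap.comp_apply, bd_single]
      exact bd_sdN _ l h1
    have := supp_eq (bd ∘ₗ sdN (k+1+1)) (sdN (k+1) ∘ₗ bd) h0 (ck_supp n r (k + 1) hk')
    rw [LinearMap.comp_apply, LinearMap.comp_apply, ih, map_add, sdN_ngc] at this
    exact this

lemma ck_zero (n r : ℕ) : ck n r 0 = Finsupp.single [ek n 0] 1 := by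
  induction r with
  | zero => rfl
  | succ r ih =>
    rw [ck, ih, sdN_succ]
    simp [bdL, sdN, bary]

lemma ev_ck (n r : ℕ) (ss : List ((Fin (n + 1) → ℝ) → ZMod 2)) (hs : ss.length ≤ n)
    (hodd : ∀ s ∈ ss, ∀ x : Fin (n + 1) → ℝ, x ≠ 0 → s (-x) = s x + 1) :
    ev (wL ss) (ck n r ss.length) = 1 := by
  induction ss with
  | nil => simp [ck_zero, wL]
  | cons s ss ih =>
    have hs' : ss.length + 1 ≤ n := by simpa using hs
    rw [List.length_cons, ← ev_pL_bd, bd_ck n r _ hs', map_add,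
      ← ih (by omega) (fun s hs => hodd s (List.mem_cons_of_mem _ hs))]
    have h0 : ∀ l ∈ goodS n ss.length ((n / (n + 1) : ℝ) ^ r * 2),
        (ev (pL s ss) + ev (pL s ss) ∘ₗ ngc) (Finsupp.single l 1) =
          (ev (wL ss)) (Finsupp.single l 1) := by
      rintro l ⟨h1, ⟨σ, h2, h3⟩, -⟩
      rw [LinearMap.add_apply, LinearMap.comp_apply, ngc_single, ev_single, ev_single, ev_single]
      apply pL_neg
      intro s' hs' x hx
      apply hodd s' hs'
      rintro rfl
      have := faceS_abs h2 (h3 _ hx)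
      simp at this
    exact supp_eq _ _ h0 (ck_supp n r _ (by omega))

theorem borsuk_ulam (n : ℕ) (g : (Fin (n + 1) → ℝ) → Fin n → ℝ) (hg : Continuous g)
    (hodd : ∀ x, g (-x) = - g x) : ∃ x, ∑ i, |x i| = 1 ∧ g x = 0 := by
  by_contra! hne
  set K : Set (Fin (n + 1) → ℝ) := {x | ∑ i, |x i| = 1} with hK
  have hKc : IsCompact K := by
    apply Metric.isCompact_of_isClosed_isBounded
    · exact isClosed_eq (by fun_prop) continuous_const
    · apply (Metric.isBounded_closedBall (x := (0 : Fin (n + 1) → ℝ)) (r := 1)).subset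
      intro x hx
      rw [mem_closedBall_zero_iff, pi_norm_le_iff_of_nonneg (by norm_num)]
      intro i
      have hx : ∑ i, |x i| = 1 := hx
      rw [← hx]
      exact Finset.single_le_sum (f := fun i => |x i|) (fun _ _ => abs_nonneg _) (Finset.mem_univ i)
  have hKne : K.Nonempty := by
    refine ⟨Pi.single 0 1, ?_⟩
    change ∑ i, |_| = 1
    rw [Finset.sum_eq_single 0]
    · simp
    · intro b _ hb; simp [hb]
    · simp
  obtain ⟨x₀, hx₀, hmin⟩ := hKc.exists_isMinOn hKne (hg.norm.continuousOn)
  set δ := ‖g x₀‖ with hδ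
  have hδpos : 0 < δ := norm_pos_iff.2 (hne x₀ hx₀)
  have huc : UniformContinuousOn g K := hKc.uniformContinuousOn_of_continuous hg.continuousOn
  obtain ⟨ε, hε, huc⟩ := Metric.uniformContinuousOn_iff.1 huc δ hδpos
  obtain ⟨r, hr⟩ : ∃ r : ℕ, (n / (n + 1) : ℝ) ^ r < ε / 2 :=
    exists_pow_lt_of_lt_one (by positivity) (by rw [div_lt_one (by positivity)]; linarith)
  -- sign functions
  classical
  let t : (Fin (n + 1) → ℝ) → ZMod 2 := fun x => if WellOrderingRel x (-x) then 1 else 0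
  have ht : ∀ x : Fin (n + 1) → ℝ, x ≠ 0 → t (-x) = t x + 1 := by
    intro x hx
    have hx' : x ≠ -x := by
      intro h; apply hx
      have : (2 : ℝ) • x = 0 := by rw [two_smul]; nth_rewrite 2 [h]; simp
      simpa using this
    simp only [t, neg_neg]
    rcases trichotomous_of WellOrderingRel x (-x) with h | h | h
    · rw [if_pos h, if_neg (fun h' => asymm_of WellOrderingRel h h')]; rfl
    · exact absurd h hx'
    · rw [if_pos h, if_neg (fun h' => asymm_of WellOrderingRel h h')]; rfl
  let s : Fin n → (Fin (n + 1) → ℝ) → ZMod 2 := fun i x =>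
    if 0 < g x i then 1 else if g x i < 0 then 0 else t x
  have hs : ∀ i, ∀ x : Fin (n + 1) → ℝ, x ≠ 0 → s i (-x) = s i x + 1 := by
    intro i x hx
    simp only [s, hodd, Pi.neg_apply, Left.neg_pos_iff, Left.neg_neg_iff]
    rcases lt_trichotomy (g x i) 0 with h | h | h
    · rw [if_pos h, if_neg h.not_gt, if_pos h]; rfl
    · simp [h, ht x hx]
    · rw [if_neg h.not_gt, if_pos h, if_pos h]; rfl
  have h1 := ev_ck n r (List.ofFn s) (by simp) (by
    intro s' hs'
    obtain ⟨i, rfl⟩ := (List.mem_ofFn' _ _).1 hs'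
    exact hs i)
  have h0 : ∀ l ∈ goodS n n ((n / (n + 1) : ℝ) ^ r * 2),
      (ev (wL (List.ofFn s))) (Finsupp.single l 1) =
        (0 : Chn (Fin (n + 1) → ℝ) →ₗ[ZMod 2] ZMod 2) (Finsupp.single l 1) := by
    rintro l ⟨g1, ⟨σ, h2, h3⟩, h4⟩
    rw [ev_single, LinearMap.zero_apply]
    apply wL_zero
    have hne' : l ≠ [] := by rintro rfl; simp at g1
    obtain ⟨z, hz⟩ := List.exists_mem_of_ne_nil l hne'
    have hzK : ∀ z ∈ l, z ∈ K := fun z hz => faceS_abs h2 (h3 z hz)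
    have hzδ : δ ≤ ‖g z‖ := hmin (hzK z hz)
    obtain ⟨i, hi⟩ : ∃ i, δ ≤ |g z i| := by
      by_contra! hcon
      exact absurd ((pi_norm_lt_iff hδpos).2 hcon) (not_lt.2 hzδ)
    have hclose : ∀ x ∈ l, |g x i - g z i| < δ := by
      intro x hx
      have := huc x (hzK x hx) z (hzK z hz) (by
        have := h4 x hx z hz
        linarith)
      rw [dist_eq_norm] at this
      exact (norm_le_pi_norm (g x - g z) i).trans_lt this
    refine ⟨s i, (List.mem_ofFn' _ _).2 ⟨i, rfl⟩, ?_⟩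
    have : ∀ x ∈ l, s i x = s i z := by
      intro x hx
      have hc := abs_lt.1 (hclose x hx)
      simp only [s]
      rcases le_abs.1 hi with h | h
      · rw [if_pos (by linarith), if_pos (by linarith)]
      · rw [if_neg (by linarith), if_pos (by linarith), if_neg (by linarith), if_pos (by linarith)]
    intro x hx y hy
    rw [this x hx, this y hy]
  have h2 := supp_eq _ _ h0 (ck_supp n r n le_rfl)
  rw [List.length_ofFn] at h1
  rw [h1, LinearMap.zero_apply] at h2
  exact one_ne_zero h2

end BU

section LinAlg

def NegK {V : Type*} [AddCommGroup V] [Module ℝ V] (B : V →ₗ[ℝ] V →ₗ[ℝ] ℝ) (k : ℕ) : Prop :=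
  ∃ v : Fin k → V, ∀ c : Fin k → ℝ, c ≠ 0 → B (∑ l, c l • v l) (∑ l, c l • v l) < 0

lemma negK_contra {V : Type*} [AddCommGroup V] [Module ℝ V] (B : V →ₗ[ℝ] V →ₗ[ℝ] ℝ)
    (hsymm : ∀ v w, B v w = B w v) (N : ℕ) (hN : ¬ NegK B (N + 1))
    (G : (Fin (N + 1) → ℝ) → V) (hodd : ∀ w, G (-w) = - G w)
    (hcont : ∀ v, Continuous fun w => B (G w) v)
    (hneg : ∀ w, ∑ i, |w i| = 1 → B (G w) (G w) < 0) : False := by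
  have h0 : NegK B 0 := ⟨fun i => i.elim0, fun c hc => absurd (Subsingleton.elim c 0) hc⟩
  obtain ⟨k, hkN, hk1, hk2⟩ : ∃ k, k ≤ N ∧ NegK B k ∧ ¬ NegK B (k + 1) := by
    by_contra! hcon
    have : ∀ k, k ≤ N + 1 → NegK B k := by
      intro k
      induction k with
      | zero => intro _; exact h0
      | succ k ih => intro hk; exact hcon k (by omega) (ih (by omega))
    exact hN (this _ le_rfl)
  obtain ⟨v, hv⟩ := hk1
  let g : (Fin (N + 1) → ℝ) → Fin N → ℝ := fun w i =>
    if h : i.val < k then B (G w) (v ⟨i.val, h⟩) else 0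
  obtain ⟨w, hw1, hw2⟩ := borsuk_ulam N g (by
    refine continuous_pi fun i => ?_
    simp only [g]
    split_ifs
    · exact hcont _
    · exact continuous_const) (by
    intro w; ext i
    simp only [g, Pi.neg_apply]
    split_ifs <;> simp [hodd])
  have horth : ∀ l, B (G w) (v l) = 0 := by
    intro l
    have := congrFun hw2 ⟨l.val, by omega⟩
    simpa [g] using this
  apply hk2
  refine ⟨Fin.cons (G w) v, fun c hc => ?_⟩
  rw [Fin.sum_univ_succ]
  simp only [Fin.cons_zero, Fin.cons_succ]
  set s := ∑ l : Fin k, c l.succ • v l with hs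
  have h1 : B (G w) s = 0 := by simp [hs, horth]
  have h2 : B s (G w) = 0 := by rw [hsymm, h1]
  have e : B (c 0 • G w + s) (c 0 • G w + s) = c 0 ^ 2 * B (G w) (G w) + B s s := by
    simp [h1, h2]; ring
  rw [e]
  have hGneg := hneg w hw1
  by_cases ht : (fun l : Fin k => c l.succ) = 0
  · have hc0 : c 0 ≠ 0 := by
      intro h; apply hc; ext i
      refine Fin.cases h (fun l => congrFun ht l) i
    have hs0 : s = 0 := by
      rw [hs]; refine Finset.sum_eq_zero fun l _ => ?_
      have := congrFun ht l
      simp only [Pi.zero_apply] at this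
      rw [this, zero_smul]
    rw [hs0]; simp
    have : 0 < c 0 ^ 2 := by positivity
    nlinarith
  · have := hv _ ht
    have h3 : 0 ≤ c 0 ^ 2 := by positivity
    have : B s s < 0 := this
    nlinarith

end LinAlg

section Form

variable {N m : ℕ}

noncomputable def qd (c : Fin m → Fin m → EuclN N → ℝ) (Ψ : Fin m → EuclN N → ℝ)
    (x : EuclN N) : ℝ :=
  (∑ i, ‖gradient (Ψ i) x‖ ^ 2) - ∑ i, ∑ j, c i j x * Ψ i x * Ψ j x

noncomputable def bl (c : Fin m → Fin m → EuclN N → ℝ) (Ψ Φ : Fin m → EuclN N → ℝ)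
    (x : EuclN N) : ℝ :=
  (∑ i, ⟪gradient (Ψ i) x, gradient (Φ i) x⟫) -
    ∑ i, ∑ j, (c i j x * Φ j x * Ψ i x + c i j x * Φ i x * Ψ j x) / 2

lemma bl_self (c : Fin m → Fin m → EuclN N → ℝ) (Ψ : Fin m → EuclN N → ℝ) (x : EuclN N) :
    bl c Ψ Ψ x = qd c Ψ x := by
  unfold bl qd
  congr 1
  · refine Finset.sum_congr rfl fun i _ => ?_
    rw [real_inner_self_eq_norm_sq]
  · refine Finset.sum_congr rfl fun i _ => Finset.sum_congr rfl fun j _ => ?_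
    ring

lemma bl_symm (c : Fin m → Fin m → EuclN N → ℝ) (Ψ Φ : Fin m → EuclN N → ℝ) (x : EuclN N) :
    bl c Ψ Φ x = bl c Φ Ψ x := by
  unfold bl
  congr 1
  · exact Finset.sum_congr rfl fun i _ => real_inner_comm _ _
  · refine Finset.sum_congr rfl fun i _ => Finset.sum_congr rfl fun j _ => ?_
    ring

lemma grad_add {u v : EuclN N → ℝ} (hu : ContDiff ℝ 1 u) (hv : ContDiff ℝ 1 v) (x : EuclN N) :
    gradient (u + v) x = gradient u x + gradient v x := by
  unfold gradient
  rw [fderiv_add (hu.differentiable (by norm_num) x) (hv.differentiable (by norm_num) x), map_add]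

lemma grad_smul {u : EuclN N → ℝ} (hu : ContDiff ℝ 1 u) (a : ℝ) (x : EuclN N) :
    gradient (a • u) x = a • gradient u x := by
  unfold gradient
  rw [fderiv_const_smul (hu.differentiable (by norm_num) x)]
  simp

lemma grad_cont {u : EuclN N → ℝ} (hu : ContDiff ℝ 1 u) : Continuous (gradient u) := by
  unfold gradient
  exact (LinearIsometryEquiv.continuous _).comp (hu.continuous_fderiv (by norm_num))

lemma grad_zero_of {u : EuclN N → ℝ} {x : EuclN N} (hx : x ∉ tsupport u) : gradient u x = 0 := by
  unfold gradient
  rw [fderiv_of_notMem_tsupport ℝ hx, map_zero]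

lemma test_add {Ω : Set (EuclN N)} {Ψ Φ : Fin m → EuclN N → ℝ} (h1 : IsTestFun Ω Ψ)
    (h2 : IsTestFun Ω Φ) : IsTestFun Ω (Ψ + Φ) := by
  intro i
  refine ⟨(h1 i).1.add (h2 i).1, (h1 i).2.1.add (h2 i).2.1, ?_⟩
  exact (tsupport_add _ _).trans (union_subset (h1 i).2.2 (h2 i).2.2)

lemma test_smul {Ω : Set (EuclN N)} {Ψ : Fin m → EuclN N → ℝ} (h1 : IsTestFun Ω Ψ)
    (a : ℝ) : IsTestFun Ω (a • Ψ) := by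
  intro i
  have hs : tsupport ((a • Ψ) i) ⊆ tsupport (Ψ i) := by
    apply closure_mono
    intro x hx
    simp only [Function.mem_support, Pi.smul_apply, smul_eq_mul] at hx ⊢
    exact right_ne_zero_of_mul hx
  refine ⟨?_, ?_, hs.trans (h1 i).2.2⟩
  · exact (contDiff_const (c := a)).smul (h1 i).1
  · exact (h1 i).2.1.of_isClosed_subset (isClosed_tsupport _) hs

lemma test_zero {Ω : Set (EuclN N)} : IsTestFun Ω (0 : Fin m → EuclN N → ℝ) := by
  intro i
  refine ⟨contDiff_const, HasCompactSupport.zero, ?_⟩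
  have : tsupport ((0 : Fin m → EuclN N → ℝ) i) = ∅ := by
    rw [tsupport_eq_empty_iff]; rfl
  rw [this]; exact empty_subset _

def testV (m : ℕ) (Ω : Set (EuclN N)) : Submodule ℝ (Fin m → EuclN N → ℝ) where
  carrier := {Ψ | IsTestFun Ω Ψ}
  add_mem' h1 h2 := test_add h1 h2
  zero_mem' := test_zero
  smul_mem' a _ h := test_smul h a

lemma cmul_cont {Ω : Set (EuclN N)} (hΩ : IsOpen Ω) {c u : EuclN N → ℝ}
    (hc : ContinuousOn c Ω) (hu : Continuous u) (hs : tsupport u ⊆ Ω) :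
    Continuous fun x => c x * u x := by
  apply continuous_of_tsupport
  intro x hx
  have hx' : x ∈ Ω := hs (tsupport_mul_subset_right hx)
  exact (hc.continuousAt (hΩ.mem_nhds hx')).mul hu.continuousAt

lemma bl_cont {Ω : Set (EuclN N)} (hΩ : IsOpen Ω) {c : Fin m → Fin m → EuclN N → ℝ}
    (hc : ∀ i j, ContinuousOn (c i j) Ω) {Ψ Φ : Fin m → EuclN N → ℝ}
    (h1 : IsTestFun Ω Ψ) (h2 : IsTestFun Ω Φ) : Continuous (bl c Ψ Φ) := by
  have a1 : ∀ i j k, Continuous fun x => c i j x * Φ k x := fun i j k =>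
    cmul_cont hΩ (hc i j) (h2 k).1.continuous (h2 k).2.2
  have a2 : ∀ i, Continuous (gradient (Ψ i)) := fun i => grad_cont (h1 i).1
  have a3 : ∀ i, Continuous (gradient (Φ i)) := fun i => grad_cont (h2 i).1
  have a4 : ∀ i, Continuous (Ψ i) := fun i => (h1 i).1.continuous
  unfold bl
  refine Continuous.sub ?_ ?_
  · exact continuous_finsetSum _ fun i _ => (a2 i).inner (a3 i)
  · refine continuous_finsetSum _ fun i _ => continuous_finsetSum _ fun j _ => ?_
    exact (((a1 i j j).mul (a4 i)).add ((a1 i j i).mul (a4 j))).div_const 2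

lemma bl_zero_of (c : Fin m → Fin m → EuclN N → ℝ) (Ψ : Fin m → EuclN N → ℝ)
    {Φ : Fin m → EuclN N → ℝ} {x : EuclN N}
    (hx : ∀ i, x ∉ tsupport (Φ i)) : bl c Ψ Φ x = 0 := by
  unfold bl
  simp [fun i => grad_zero_of (hx i), fun i => image_eq_zero_of_notMem_tsupport (hx i)]

lemma supp_compact {Ω : Set (EuclN N)} {Φ : Fin m → EuclN N → ℝ} (h2 : IsTestFun Ω Φ) :
    IsCompact (⋃ i, tsupport (Φ i)) := isCompact_iUnion fun i => (h2 i).2.1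

lemma bl_int {Ω : Set (EuclN N)} (hΩ : IsOpen Ω) {c : Fin m → Fin m → EuclN N → ℝ}
    (hc : ∀ i j, ContinuousOn (c i j) Ω) {Ψ Φ : Fin m → EuclN N → ℝ}
    (h1 : IsTestFun Ω Ψ) (h2 : IsTestFun Ω Φ) : Integrable (bl c Ψ Φ) := by
  refine (bl_cont hΩ hc h1 h2).integrable_of_hasCompactSupport
    (HasCompactSupport.intro (supp_compact h2) fun x hx => ?_)
  exact bl_zero_of c Ψ (fun i hi => hx (mem_iUnion.2 ⟨i, hi⟩))

lemma bl_add (c : Fin m → Fin m → EuclN N → ℝ) {Ω : Set (EuclN N)}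
    {Ψ₁ Ψ₂ : Fin m → EuclN N → ℝ} (Φ : Fin m → EuclN N → ℝ)
    (h1 : IsTestFun Ω Ψ₁) (h2 : IsTestFun Ω Ψ₂) (x : EuclN N) :
    bl c (Ψ₁ + Ψ₂) Φ x = bl c Ψ₁ Φ x + bl c Ψ₂ Φ x := by
  unfold bl
  simp only [Pi.add_apply, fun i => grad_add (h1 i).1 (h2 i).1 x, inner_add_left,
    Finset.sum_add_distrib]
  rw [sub_add_sub_comm]
  congr 1
  rw [← Finset.sum_add_distrib]
  refine Finset.sum_congr rfl fun i _ => ?_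
  rw [← Finset.sum_add_distrib]
  refine Finset.sum_congr rfl fun j _ => ?_
  ring

lemma bl_smul (c : Fin m → Fin m → EuclN N → ℝ) {Ω : Set (EuclN N)}
    {Ψ : Fin m → EuclN N → ℝ} (Φ : Fin m → EuclN N → ℝ)
    (h1 : IsTestFun Ω Ψ) (a : ℝ) (x : EuclN N) :
    bl c (a • Ψ) Φ x = a * bl c Ψ Φ x := by
  unfold bl
  simp only [Pi.smul_apply, fun i => grad_smul (h1 i).1 a x, inner_smul_left, mul_sub,
    Finset.mul_sum, smul_eq_mul]
  congr 1
  refine Finset.sum_congr rfl fun i _ => ?_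
  refine Finset.sum_congr rfl fun j _ => ?_
  ring

noncomputable def BV {Ω : Set (EuclN N)} (hΩ : IsOpen Ω) {c : Fin m → Fin m → EuclN N → ℝ}
    (hc : ∀ i j, ContinuousOn (c i j) Ω) : testV m Ω →ₗ[ℝ] testV m Ω →ₗ[ℝ] ℝ :=
  LinearMap.mk₂ ℝ (fun Ψ Φ => ∫ x, bl c Ψ.1 Φ.1 x)
    (by
      intro Ψ₁ Ψ₂ Φ
      rw [← integral_add (bl_int hΩ hc Ψ₁.2 Φ.2) (bl_int hΩ hc Ψ₂.2 Φ.2)]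
      exact integral_congr_ae (Filter.Eventually.of_forall fun x => bl_add c Φ.1 Ψ₁.2 Ψ₂.2 x))
    (by
      intro a Ψ Φ
      rw [smul_eq_mul, ← integral_const_mul]
      exact integral_congr_ae (Filter.Eventually.of_forall fun x => bl_smul c Φ.1 Ψ.2 a x))
    (by
      intro Φ Ψ₁ Ψ₂
      rw [← integral_add (bl_int hΩ hc Φ.2 Ψ₁.2) (bl_int hΩ hc Φ.2 Ψ₂.2)]
      refine integral_congr_ae (Filter.Eventually.of_forall fun x => ?_)
      simp only [bl_symm c Φ.1]
      exact bl_add c Φ.1 Ψ₁.2 Ψ₂.2 x)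
    (by
      intro a Φ Ψ
      rw [smul_eq_mul, ← integral_const_mul]
      refine integral_congr_ae (Filter.Eventually.of_forall fun x => ?_)
      simp only [bl_symm c Φ.1]
      exact bl_smul c Φ.1 Ψ.2 a x)

lemma BV_apply {Ω : Set (EuclN N)} (hΩ : IsOpen Ω) {c : Fin m → Fin m → EuclN N → ℝ}
    (hc : ∀ i j, ContinuousOn (c i j) Ω) (Ψ Φ : testV m Ω) :
    BV hΩ hc Ψ Φ = ∫ x, bl c Ψ.1 Φ.1 x := rfl

lemma BV_self {Ω : Set (EuclN N)} (hΩ : IsOpen Ω) {c : Fin m → Fin m → EuclN N → ℝ}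
    (hc : ∀ i j, ContinuousOn (c i j) Ω) (Ψ : testV m Ω) :
    BV hΩ hc Ψ Ψ = ∫ x, qd c Ψ.1 x := by
  rw [BV_apply]; simp only [bl_self]

lemma qd_int {Ω : Set (EuclN N)} (hΩ : IsOpen Ω) {c : Fin m → Fin m → EuclN N → ℝ}
    (hc : ∀ i j, ContinuousOn (c i j) Ω) {Ψ : Fin m → EuclN N → ℝ}
    (h1 : IsTestFun Ω Ψ) : Integrable (qd c Ψ) := by
  have := bl_int hΩ hc h1 h1
  exact this.congr (Filter.Eventually.of_forall fun x => bl_self c Ψ x)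

lemma qd_zero_of (c : Fin m → Fin m → EuclN N → ℝ)
    {Φ : Fin m → EuclN N → ℝ} {x : EuclN N}
    (hx : ∀ i, x ∉ tsupport (Φ i)) : qd c Φ x = 0 := by
  rw [← bl_self]; exact bl_zero_of c Φ hx

end Form

section Mix

variable {N m : ℕ} {ι : Type*} [Fintype ι]

noncomputable def aS (Ψ : ι → Fin m → EuclN N → ℝ) (b : ι → ℝ) (i : Fin m) (x : EuclN N) : ℝ :=
  ∑ k, b k * Ψ k i x ^ 2

noncomputable def pM (Ψ : ι → Fin m → EuclN N → ℝ) (δ : ℝ) (b : ι → ℝ) : Fin m → EuclN N → ℝ :=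
  fun i x => √(aS Ψ b i x + δ ^ 2) - δ

noncomputable def gM (Ψ : ι → Fin m → EuclN N → ℝ) (δ : ℝ) (b : ι → ℝ) (i : Fin m)
    (x : EuclN N) : EuclN N :=
  ∑ k, (b k * Ψ k i x / √(aS Ψ b i x + δ ^ 2)) • gradient (Ψ k i) x

lemma aS_nonneg (Ψ : ι → Fin m → EuclN N → ℝ) {b : ι → ℝ} (hb : ∀ k, 0 ≤ b k) (i : Fin m)
    (x : EuclN N) : 0 ≤ aS Ψ b i x :=
  Finset.sum_nonneg fun k _ => mul_nonneg (hb k) (sq_nonneg _)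

lemma aS_pos (Ψ : ι → Fin m → EuclN N → ℝ) {δ : ℝ} (hδ : 0 < δ) {b : ι → ℝ}
    (hb : ∀ k, 0 ≤ b k) (i : Fin m) (x : EuclN N) : 0 < aS Ψ b i x + δ ^ 2 := by
  have := aS_nonneg Ψ hb i x
  positivity

lemma pM_contDiff {Ω : Set (EuclN N)} {Ψ : ι → Fin m → EuclN N → ℝ}
    (hΨ : ∀ k, IsTestFun Ω (Ψ k)) {δ : ℝ} (hδ : 0 < δ) {b : ι → ℝ} (hb : ∀ k, 0 ≤ b k)
    (i : Fin m) : ContDiff ℝ 1 (pM Ψ δ b i) := by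
  unfold pM
  refine ContDiff.sub ?_ contDiff_const
  refine ContDiff.sqrt ?_ fun x => (aS_pos Ψ hδ hb i x).ne'
  refine ContDiff.add ?_ contDiff_const
  unfold aS
  exact ContDiff.sum fun k _ => contDiff_const.mul ((hΨ k i).1.pow 2)

lemma pM_zero {Ψ : ι → Fin m → EuclN N → ℝ} {δ : ℝ} (hδ : 0 < δ) {b : ι → ℝ}
    {i : Fin m} {x : EuclN N} (h : ∀ k, b k ≠ 0 → Ψ k i x = 0) : pM Ψ δ b i x = 0 := by
  have : aS Ψ b i x = 0 := by
    unfold aS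
    refine Finset.sum_eq_zero fun k _ => ?_
    by_cases hk : b k = 0
    · simp [hk]
    · simp [h k hk]
  simp [pM, this, Real.sqrt_sq hδ.le]

lemma gM_zero {Ψ : ι → Fin m → EuclN N → ℝ} {δ : ℝ} {b : ι → ℝ}
    {i : Fin m} {x : EuclN N} (h : ∀ k, b k ≠ 0 → Ψ k i x = 0) : gM Ψ δ b i x = 0 := by
  unfold gM
  refine Finset.sum_eq_zero fun k _ => ?_
  by_cases hk : b k = 0
  · simp [hk]
  · simp [h k hk]

lemma pM_test {Ω : Set (EuclN N)} {Ψ : ι → Fin m → EuclN N → ℝ}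
    (hΨ : ∀ k, IsTestFun Ω (Ψ k)) {δ : ℝ} (hδ : 0 < δ) {b : ι → ℝ} (hb : ∀ k, 0 ≤ b k) :
    IsTestFun Ω (pM Ψ δ b) := by
  intro i
  have hc : IsCompact (⋃ k, tsupport (Ψ k i)) := isCompact_iUnion fun k => (hΨ k i).2.1
  have hs : tsupport (pM Ψ δ b i) ⊆ ⋃ k, tsupport (Ψ k i) := by
    refine closure_minimal ?_ hc.isClosed
    intro x hx
    by_contra hcon
    apply hx
    apply pM_zero hδ
    intro k _
    exact image_eq_zero_of_notMem_tsupport fun h => hcon (mem_iUnion.2 ⟨k, h⟩)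
  refine ⟨pM_contDiff hΨ hδ hb i, hc.of_isClosed_subset (isClosed_tsupport _) hs, ?_⟩
  exact hs.trans (iUnion_subset fun k => (hΨ k i).2.2)

lemma pM_grad {Ω : Set (EuclN N)} {Ψ : ι → Fin m → EuclN N → ℝ}
    (hΨ : ∀ k, IsTestFun Ω (Ψ k)) {δ : ℝ} (hδ : 0 < δ) {b : ι → ℝ} (hb : ∀ k, 0 ≤ b k)
    (i : Fin m) (x : EuclN N) : gradient (pM Ψ δ b i) x = gM Ψ δ b i x := by
  have hd : ∀ k, HasFDerivAt (Ψ k i) (fderiv ℝ (Ψ k i) x) x := fun k =>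
    ((hΨ k i).1.differentiable (by norm_num) x).hasFDerivAt
  have h1 : HasFDerivAt (fun x => aS Ψ b i x + δ ^ 2)
      (∑ k, b k • ((2 * Ψ k i x) • fderiv ℝ (Ψ k i) x)) x := by
    unfold aS
    refine HasFDerivAt.add_const _ ?_
    refine HasFDerivAt.fun_sum fun k _ => ?_
    refine HasFDerivAt.const_mul ?_ _
    simpa using (hd k).pow 2
  have h2 := (h1.sqrt (aS_pos Ψ hδ hb i x).ne').sub_const δ
  have h3 : fderiv ℝ (pM Ψ δ b i) x = _ := h2.fderiv
  unfold gradient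
  rw [h3, gM]
  simp only [map_smul, map_sum, Finset.smul_sum, smul_smul]
  refine Finset.sum_congr rfl fun k _ => ?_
  unfold gradient
  have : √(aS Ψ b i x + δ ^ 2) ≠ 0 := (Real.sqrt_pos.2 (aS_pos Ψ hδ hb i x)).ne'
  congr 1
  field_simp

lemma gM_le (Ψ : ι → Fin m → EuclN N → ℝ) {δ : ℝ} (hδ : 0 < δ) {b : ι → ℝ}
    (hb : ∀ k, 0 ≤ b k) (i : Fin m) (x : EuclN N) :
    ‖gM Ψ δ b i x‖ ^ 2 ≤ ∑ k, b k * ‖gradient (Ψ k i) x‖ ^ 2 := by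
  set s := √(aS Ψ b i x + δ ^ 2) with hs
  have hpos := aS_pos Ψ hδ hb i x
  have hspos : 0 < s := Real.sqrt_pos.2 hpos
  have hs2 : s ^ 2 = aS Ψ b i x + δ ^ 2 := Real.sq_sqrt hpos.le
  set D := ∑ k, b k * ‖gradient (Ψ k i) x‖ ^ 2 with hD
  have hDn : 0 ≤ D := Finset.sum_nonneg fun k _ => mul_nonneg (hb k) (sq_nonneg _)
  have h1 : ‖gM Ψ δ b i x‖ ≤ (∑ k, b k * |Ψ k i x| * ‖gradient (Ψ k i) x‖) / s := by
    unfold gM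
    refine (norm_sum_le _ _).trans (le_of_eq ?_)
    rw [Finset.sum_div]
    refine Finset.sum_congr rfl fun k _ => ?_
    rw [norm_smul, Real.norm_eq_abs, abs_div, abs_mul, abs_of_nonneg (hb k), ← hs,
      abs_of_pos hspos]
    ring
  have h2 : (∑ k, b k * |Ψ k i x| * ‖gradient (Ψ k i) x‖) ^ 2 ≤ aS Ψ b i x * D := by
    refine Finset.sum_sq_le_sum_mul_sum_of_sq_le_mul _
      (fun k _ => mul_nonneg (hb k) (sq_nonneg _)) (fun k _ => mul_nonneg (hb k) (sq_nonneg _)) ?_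
    intro k _
    rw [← sq_abs (Ψ k i x)]
    apply le_of_eq; ring
  calc ‖gM Ψ δ b i x‖ ^ 2
      ≤ ((∑ k, b k * |Ψ k i x| * ‖gradient (Ψ k i) x‖) / s) ^ 2 := by gcongr
    _ = (∑ k, b k * |Ψ k i x| * ‖gradient (Ψ k i) x‖) ^ 2 / s ^ 2 := by rw [div_pow]
    _ ≤ D := by
      rw [div_le_iff₀ (by positivity), hs2]
      nlinarith [sq_nonneg δ, mul_nonneg hDn (sq_nonneg δ)]

lemma sq_bounds {A δ : ℝ} (hA : 0 ≤ A) (hδ : 0 < δ) :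
    0 ≤ √(A + δ ^ 2) - δ ∧ √(A + δ ^ 2) - δ ≤ √A ∧ √A - δ ≤ √(A + δ ^ 2) - δ := by
  refine ⟨?_, ?_, ?_⟩
  · rw [sub_nonneg]; apply Real.le_sqrt_of_sq_le; linarith
  · rw [sub_le_iff_le_add]
    apply Real.sqrt_le_iff.2
    refine ⟨by positivity, ?_⟩
    have := Real.sq_sqrt hA
    have := Real.sqrt_nonneg A
    nlinarith
  · gcongr; nlinarith

lemma zero_term (Ψ : ι → Fin m → EuclN N → ℝ) {δ : ℝ} (hδ : 0 < δ) {b : ι → ℝ}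
    (hb : ∀ k, 0 ≤ b k) (i j : Fin m) (x : EuclN N) (c : ℝ)
    (hc : i ≠ j → 0 ≤ c ∨ ∀ k, Ψ k i x = 0) :
    ∑ k, b k * (c * Ψ k i x * Ψ k j x) - |c| * (δ * (√(aS Ψ b i x) + √(aS Ψ b j x))) ≤
      c * pM Ψ δ b i x * pM Ψ δ b j x := by
  obtain ⟨i1, i2, i3⟩ := sq_bounds (aS_nonneg Ψ hb i x) hδ
  obtain ⟨j1, j2, j3⟩ := sq_bounds (aS_nonneg Ψ hb j x) hδ
  change 0 ≤ pM Ψ δ b i x at i1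
  change pM Ψ δ b i x ≤ _ at i2
  change _ ≤ pM Ψ δ b i x at i3
  change 0 ≤ pM Ψ δ b j x at j1
  change pM Ψ δ b j x ≤ _ at j2
  change _ ≤ pM Ψ δ b j x at j3
  have e : ∑ k, b k * (c * Ψ k i x * Ψ k j x) = c * ∑ k, b k * (Ψ k i x * Ψ k j x) := by
    rw [Finset.mul_sum]; exact Finset.sum_congr rfl fun k _ => by ring
  rw [e]
  have ni := Real.sqrt_nonneg (aS Ψ b i x)
  have nj := Real.sqrt_nonneg (aS Ψ b j x)
  have si := Real.sq_sqrt (aS_nonneg Ψ hb i x)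
  have sj := Real.sq_sqrt (aS_nonneg Ψ hb j x)
  have key : √(aS Ψ b i x) * √(aS Ψ b j x) - pM Ψ δ b i x * pM Ψ δ b j x ≤
      δ * (√(aS Ψ b i x) + √(aS Ψ b j x)) := by nlinarith
  have key0 : pM Ψ δ b i x * pM Ψ δ b j x ≤ √(aS Ψ b i x) * √(aS Ψ b j x) := by gcongr
  by_cases hij : i = j
  · subst hij
    have e2 : ∑ k, b k * (Ψ k i x * Ψ k i x) = aS Ψ b i x :=
      Finset.sum_congr rfl fun k _ => by ring
    rw [e2]
    set A := aS Ψ b i x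
    set S := √A
    set p := pM Ψ δ b i x
    have h1 : c * (S ^ 2 - p * p) ≤ |c| * (S ^ 2 - p * p) :=
      mul_le_mul_of_nonneg_right (le_abs_self c) (by nlinarith)
    have h2 : |c| * (S ^ 2 - p * p) ≤ |c| * (δ * (S + S)) :=
      mul_le_mul_of_nonneg_left (by nlinarith) (abs_nonneg c)
    rw [si] at h1 h2
    linarith
  · rcases hc hij with hc | hc
    · have cs : ∑ k, b k * (Ψ k i x * Ψ k j x) ≤ √(aS Ψ b i x) * √(aS Ψ b j x) := by
        rw [← Real.sqrt_mul (aS_nonneg Ψ hb i x)]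
        apply Real.le_sqrt_of_sq_le
        refine Finset.sum_sq_le_sum_mul_sum_of_sq_le_mul _
          (fun k _ => mul_nonneg (hb k) (sq_nonneg _)) (fun k _ => mul_nonneg (hb k) (sq_nonneg _)) ?_
        intro k _
        apply le_of_eq; ring
      rw [abs_of_nonneg hc]
      have h1 := mul_le_mul_of_nonneg_left cs hc
      have h2 := mul_le_mul_of_nonneg_left key hc
      nlinarith
    · have hp : pM Ψ δ b i x = 0 := pM_zero hδ fun k _ => hc k
      have hs0 : ∑ k, b k * (Ψ k i x * Ψ k j x) = 0 :=
        Finset.sum_eq_zero fun k _ => by simp [hc k]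
      rw [hp, hs0]
      have : 0 ≤ |c| * (δ * (√(aS Ψ b i x) + √(aS Ψ b j x))) := by positivity
      linarith

noncomputable def tS (Ψ : ι → Fin m → EuclN N → ℝ) (i : Fin m) (x : EuclN N) : ℝ :=
  ∑ k, |Ψ k i x|

noncomputable def hE (c : Fin m → Fin m → EuclN N → ℝ) (Ψ : ι → Fin m → EuclN N → ℝ)
    (x : EuclN N) : ℝ :=
  ∑ i, ∑ j, (|c i j x| * tS Ψ i x + |c i j x| * tS Ψ j x)

lemma hE_nonneg (c : Fin m → Fin m → EuclN N → ℝ) (Ψ : ι → Fin m → EuclN N → ℝ)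
    (x : EuclN N) : 0 ≤ hE c Ψ x := by
  unfold hE tS
  positivity

lemma hE_int {Ω : Set (EuclN N)} (hΩ : IsOpen Ω) {c : Fin m → Fin m → EuclN N → ℝ}
    (hc : ∀ i j, ContinuousOn (c i j) Ω) {Ψ : ι → Fin m → EuclN N → ℝ}
    (hΨ : ∀ k, IsTestFun Ω (Ψ k)) : Integrable (hE c Ψ) := by
  have key : ∀ i j l, Integrable (fun x => |c i j x| * tS Ψ l x) := by
    intro i j l
    unfold tS
    simp only [Finset.mul_sum]
    refine integrable_finsetSum _ fun k _ => ?_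
    have h1 : Continuous fun x => c i j x * Ψ k l x :=
      cmul_cont hΩ (hc i j) (hΨ k l).1.continuous (hΨ k l).2.2
    have h2 : Integrable fun x => c i j x * Ψ k l x :=
      h1.integrable_of_hasCompactSupport (HasCompactSupport.mul_left (hΨ k l).2.1)
    simpa only [← abs_mul] using h2.abs
  unfold hE
  exact integrable_finsetSum _ fun i _ => integrable_finsetSum _ fun j _ =>
    (key i j i).add (key i j j)

lemma sqrt_aS_le (Ψ : ι → Fin m → EuclN N → ℝ) {b : ι → ℝ} {M : ℝ} (hM : 0 ≤ M)
    (hb : ∀ k, 0 ≤ b k) (hbM : ∀ k, b k ≤ M ^ 2) (i : Fin m) (x : EuclN N) :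
    √(aS Ψ b i x) ≤ M * tS Ψ i x := by
  have ht : 0 ≤ tS Ψ i x := Finset.sum_nonneg fun k _ => abs_nonneg _
  apply Real.sqrt_le_iff.2
  refine ⟨by positivity, ?_⟩
  rw [mul_pow]
  have h1 : ∑ k, |Ψ k i x| ^ 2 ≤ (tS Ψ i x) ^ 2 :=
    Finset.sum_sq_le_sq_sum_of_nonneg fun k _ => abs_nonneg _
  calc aS Ψ b i x ≤ ∑ k, M ^ 2 * |Ψ k i x| ^ 2 := by
        unfold aS
        refine Finset.sum_le_sum fun k _ => ?_
        rw [sq_abs]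
        exact mul_le_mul_of_nonneg_right (hbM k) (sq_nonneg _)
    _ = M ^ 2 * ∑ k, |Ψ k i x| ^ 2 := by rw [Finset.mul_sum]
    _ ≤ _ := by gcongr

lemma qd_pM_le {Ω : Set (EuclN N)} (c : Fin m → Fin m → EuclN N → ℝ)
    {Ψ : ι → Fin m → EuclN N → ℝ} (hΨ : ∀ k, IsTestFun Ω (Ψ k)) {δ : ℝ} (hδ : 0 < δ)
    {b : ι → ℝ} {M : ℝ} (hM : 0 ≤ M)
    (hb : ∀ k, 0 ≤ b k) (hbM : ∀ k, b k ≤ M ^ 2) (x : EuclN N)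
    (hc : ∀ i j, i ≠ j → 0 ≤ c i j x ∨ ∀ k, Ψ k i x = 0) :
    qd c (pM Ψ δ b) x ≤ ∑ k, b k * qd c (Ψ k) x + δ * M * hE c Ψ x := by
  have h1 : ∑ i, ‖gradient (pM Ψ δ b i) x‖ ^ 2 ≤ ∑ k, b k * ∑ i, ‖gradient (Ψ k i) x‖ ^ 2 := by
    simp only [Finset.mul_sum]
    rw [Finset.sum_comm]
    refine Finset.sum_le_sum fun i _ => ?_
    rw [pM_grad hΨ hδ hb]
    exact gM_le Ψ hδ hb i x
  have h2 : ∑ k, b k * (∑ i, ∑ j, c i j x * Ψ k i x * Ψ k j x) - δ * M * hE c Ψ x ≤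
      ∑ i, ∑ j, c i j x * pM Ψ δ b i x * pM Ψ δ b j x := by
    have e : ∑ k, b k * (∑ i, ∑ j, c i j x * Ψ k i x * Ψ k j x) =
        ∑ i, ∑ j, ∑ k, b k * (c i j x * Ψ k i x * Ψ k j x) := by
      simp only [Finset.mul_sum]
      rw [Finset.sum_comm]
      refine Finset.sum_congr rfl fun i _ => ?_
      rw [Finset.sum_comm]
    rw [e, hE, Finset.mul_sum, ← Finset.sum_sub_distrib]
    refine Finset.sum_le_sum fun i _ => ?_
    rw [Finset.mul_sum, ← Finset.sum_sub_distrib]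
    refine Finset.sum_le_sum fun j _ => ?_
    refine le_trans ?_ (zero_term Ψ hδ hb i j x (c i j x) (hc i j))
    have := sqrt_aS_le Ψ hM hb hbM i x
    have := sqrt_aS_le Ψ hM hb hbM j x
    have h3 : |c i j x| * (δ * (√(aS Ψ b i x) + √(aS Ψ b j x))) ≤
        |c i j x| * (δ * (M * tS Ψ i x + M * tS Ψ j x)) := by gcongr
    linarith
  have e : ∑ k, b k * qd c (Ψ k) x = ∑ k, b k * ∑ i, ‖gradient (Ψ k i) x‖ ^ 2 -
      ∑ k, b k * (∑ i, ∑ j, c i j x * Ψ k i x * Ψ k j x) := by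
    rw [← Finset.sum_sub_distrib]
    exact Finset.sum_congr rfl fun k _ => by rw [qd]; ring
  rw [e, qd]
  linarith

end Mix

section Mix2

variable {N m : ℕ} {ι : Type*} [Fintype ι]

lemma qd_neg (c : Fin m → Fin m → EuclN N → ℝ) (Ψ : Fin m → EuclN N → ℝ) (x : EuclN N) :
    qd c (-Ψ) x = qd c Ψ x := by
  have h : ∀ i, gradient ((-Ψ) i) x = - gradient (Ψ i) x := by
    intro i
    unfold gradient
    rw [Pi.neg_apply, fderiv_neg, map_neg]
  unfold qd
  simp only [h, norm_neg]
  simp only [Pi.neg_apply, mul_neg, neg_mul, neg_neg]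

lemma qd_mix {Ω : Set (EuclN N)} (c : Fin m → Fin m → EuclN N → ℝ)
    {Ψ : ι → Fin m → EuclN N → ℝ} (hΨ : ∀ k, IsTestFun Ω (Ψ k)) {δ : ℝ} (hδ : 0 < δ)
    {b b' : ι → ℝ} {M : ℝ} (hM : 0 ≤ M)
    (hb : ∀ k, 0 ≤ b k) (hbM : ∀ k, b k ≤ M ^ 2) (hb' : ∀ k, 0 ≤ b' k) (x : EuclN N)
    (hc : ∀ i j, i ≠ j → 0 ≤ c i j x ∨ ∀ k, Ψ k i x = 0)
    (hx : ∀ k i, b' k ≠ 0 → x ∉ tsupport (Ψ k i)) :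
    qd c (pM Ψ δ b - pM Ψ δ b') x ≤ ∑ k, (b k + b' k) * qd c (Ψ k) x + δ * M * hE c Ψ x := by
  have hz : ∀ i k, b' k ≠ 0 → Ψ k i x = 0 := fun i k hk =>
    image_eq_zero_of_notMem_tsupport (hx k i hk)
  have hv : ∀ i, (pM Ψ δ b - pM Ψ δ b') i x = pM Ψ δ b i x := by
    intro i
    rw [Pi.sub_apply, Pi.sub_apply, pM_zero hδ (hz i), sub_zero]
  have hg : ∀ i, gradient ((pM Ψ δ b - pM Ψ δ b') i) x = gradient (pM Ψ δ b i) x := by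
    intro i
    have h0 : gradient (pM Ψ δ b' i) x = 0 := by
      rw [pM_grad hΨ hδ hb', gM_zero (hz i)]
    unfold gradient at h0 ⊢
    rw [Pi.sub_apply, fderiv_sub ((pM_contDiff hΨ hδ hb i).differentiable (by norm_num) x)
      ((pM_contDiff hΨ hδ hb' i).differentiable (by norm_num) x), map_sub, h0, sub_zero]
  have e1 : qd c (pM Ψ δ b - pM Ψ δ b') x = qd c (pM Ψ δ b) x := by
    unfold qd
    simp only [hv, hg]
  have e2 : ∑ k, (b k + b' k) * qd c (Ψ k) x = ∑ k, b k * qd c (Ψ k) x := by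
    refine Finset.sum_congr rfl fun k _ => ?_
    by_cases hk : b' k = 0
    · rw [hk, add_zero]
    · rw [qd_zero_of c fun i => hx k i hk, mul_zero, mul_zero]
  rw [e1, e2]
  exact qd_pM_le c hΨ hδ hM hb hbM x hc

lemma pM_bl_cont {X : Type*} [TopologicalSpace X] [FirstCountableTopology X]
    [LocallyCompactSpace X] {Ω : Set (EuclN N)} (hΩ : IsOpen Ω)
    {c : Fin m → Fin m → EuclN N → ℝ} (hc : ∀ i j, ContinuousOn (c i j) Ω)
    {Ψ : ι → Fin m → EuclN N → ℝ} (hΨ : ∀ k, IsTestFun Ω (Ψ k)) {δ : ℝ} (hδ : 0 < δ)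
    {a : ι → X → ℝ} (ha : ∀ k, Continuous (a k)) (ha0 : ∀ k w, 0 ≤ a k w)
    {Φ : Fin m → EuclN N → ℝ} (hΦ : IsTestFun Ω Φ) :
    Continuous fun w => ∫ x, bl c (pM Ψ δ fun k => a k w) Φ x := by
  have e : (fun w => ∫ x, bl c (pM Ψ δ fun k => a k w) Φ x) =
      fun w => ∫ x in ⋃ i, tsupport (Φ i), bl c (pM Ψ δ fun k => a k w) Φ x := by
    ext w
    refine (setIntegral_eq_integral_of_forall_compl_eq_zero fun x hx => ?_).symm
    exact bl_zero_of c _ (fun i hi => hx (mem_iUnion.2 ⟨i, hi⟩))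
  rw [e]
  refine continuous_parametric_integral_of_continuous
    (f := fun w x => bl c (pM Ψ δ fun k => a k w) Φ x) ?_ (supp_compact hΦ)
  have a1 : ∀ i j k, Continuous fun x => c i j x * Φ k x := fun i j k =>
    cmul_cont hΩ (hc i j) (hΦ k).1.continuous (hΦ k).2.2
  have a2 : ∀ k i, Continuous (Ψ k i) := fun k i => (hΨ k i).1.continuous
  have a3 : ∀ k i, Continuous (gradient (Ψ k i)) := fun k i => grad_cont (hΨ k i).1
  have a4 : ∀ i, Continuous (gradient (Φ i)) := fun i => grad_cont (hΦ i).1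
  have s1 : ∀ i, Continuous fun q : X × EuclN N =>
      √(aS Ψ (fun k => a k q.1) i q.2 + δ ^ 2) := by
    intro i
    unfold aS
    refine Real.continuous_sqrt.comp (Continuous.add ?_ continuous_const)
    refine continuous_finsetSum _ fun k _ => ?_
    exact ((ha k).comp continuous_fst).mul (((a2 k i).comp continuous_snd).pow 2)
  have s2 : ∀ i, Continuous fun q : X × EuclN N => pM Ψ δ (fun k => a k q.1) i q.2 := by
    intro i
    exact (s1 i).sub continuous_const
  have s3 : ∀ i, Continuous fun q : X × EuclN N => gM Ψ δ (fun k => a k q.1) i q.2 := by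
    intro i
    unfold gM
    refine continuous_finsetSum _ fun k _ =>
      Continuous.fun_smul ?_ ((a3 k i).comp continuous_snd)
    refine Continuous.div ?_ (s1 i) ?_
    · exact ((ha k).comp continuous_fst).mul ((a2 k i).comp continuous_snd)
    · intro q
      exact (Real.sqrt_pos.2 (aS_pos Ψ hδ (fun k => ha0 k q.1) i q.2)).ne'
  have e2 : (Function.uncurry fun w x => bl c (pM Ψ δ fun k => a k w) Φ x) = fun q =>
      (∑ i, ⟪gM Ψ δ (fun k => a k q.1) i q.2, gradient (Φ i) q.2⟫) -
      ∑ i, ∑ j, (c i j q.2 * Φ j q.2 * pM Ψ δ (fun k => a k q.1) i q.2 +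
        c i j q.2 * Φ i q.2 * pM Ψ δ (fun k => a k q.1) j q.2) / 2 := by
    ext q
    simp only [Function.uncurry, bl]
    simp only [fun i => pM_grad hΨ hδ (fun k => ha0 k q.1) i q.2]
  rw [e2]
  refine Continuous.sub ?_ ?_
  · exact continuous_finsetSum _ fun i _ => (s3 i).inner ((a4 i).comp continuous_snd)
  · refine continuous_finsetSum _ fun i _ => continuous_finsetSum _ fun j _ => ?_
    exact ((((a1 i j j).comp continuous_snd).mul (s2 i)).add
      (((a1 i j i).comp continuous_snd).mul (s2 j))).div_const 2

lemma l1_compact (n : ℕ) : IsCompact {w : Fin n → ℝ | ∑ i, |w i| = 1} := by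
  refine Metric.isCompact_of_isClosed_isBounded ?_ ?_
  · exact isClosed_eq (by fun_prop) continuous_const
  · refine (Metric.isBounded_closedBall (x := (0 : Fin n → ℝ)) (r := 1)).subset ?_
    intro w hw
    rw [mem_closedBall_zero_iff, pi_norm_le_iff_of_nonneg zero_le_one]
    intro i
    rw [Real.norm_eq_abs, ← (show ∑ i, |w i| = 1 from hw)]
    exact Finset.single_le_sum (f := fun i => |w i|) (fun i _ => abs_nonneg _) (Finset.mem_univ i)

lemma mix_contra {Ω : Set (EuclN N)} (hΩ : IsOpen Ω)
    {c : Fin m → Fin m → EuclN N → ℝ} (hc : ∀ i j, ContinuousOn (c i j) Ω)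
    {Ψ : ι → Fin m → EuclN N → ℝ} (hΨ : ∀ k, IsTestFun Ω (Ψ k))
    (hcoop : ∀ x i j, i ≠ j → 0 ≤ c i j x ∨ ∀ k, Ψ k i x = 0)
    (hQ : ∀ k, ∫ x, qd c (Ψ k) x < 0) (n : ℕ)
    {a : ι → (Fin (n + 1) → ℝ) → ℝ} (ha : ∀ k, Continuous (a k)) (ha0 : ∀ k w, 0 ≤ a k w)
    (hdis : ∀ w x, (∀ k i, a k w ≠ 0 → x ∉ tsupport (Ψ k i)) ∨
      (∀ k i, a k (-w) ≠ 0 → x ∉ tsupport (Ψ k i)))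
    (hcov : ∀ w, ∑ i, |w i| = 1 → ∃ k, 0 < a k w ∨ 0 < a k (-w))
    (hNeg : ¬ NegK (BV hΩ hc) (n + 1)) : False := by
  have hK := l1_compact (n + 1)
  have han : ∀ k, Continuous fun w => a k (-w) := fun k => (ha k).comp continuous_neg
  obtain ⟨η, hη, hF⟩ : ∃ η : ℝ, 0 < η ∧ ∀ w ∈ {w : Fin (n + 1) → ℝ | ∑ i, |w i| = 1},
      η ≤ -∑ k, (a k w + a k (-w)) * ∫ x, qd c (Ψ k) x := by
    refine hK.exists_forall_le' ?_ ?_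
    · refine Continuous.continuousOn ?_
      refine Continuous.neg (continuous_finsetSum _ fun k _ => ?_)
      exact ((ha k).add (han k)).mul continuous_const
    · intro w hw
      rw [neg_pos]
      obtain ⟨k, hk⟩ := hcov w hw
      refine Finset.sum_neg' (fun k _ => ?_) ⟨k, Finset.mem_univ k, ?_⟩
      · exact mul_nonpos_of_nonneg_of_nonpos (add_nonneg (ha0 _ _) (ha0 _ _)) (hQ k).le
      · refine mul_neg_of_pos_of_neg ?_ (hQ k)
        have := ha0 k w
        have := ha0 k (-w)
        rcases hk with hk | hk <;> linarith
  obtain ⟨M, hM, hMb⟩ : ∃ M : ℝ, 0 ≤ M ∧ ∀ w ∈ {w : Fin (n + 1) → ℝ | ∑ i, |w i| = 1},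
      ∀ k, a k w ≤ M ^ 2 := by
    obtain ⟨C, hC⟩ := hK.exists_bound_of_continuousOn (f := fun w => ∑ k, a k w)
      (continuous_finsetSum _ fun k _ => ha k).continuousOn
    refine ⟨|C| + 1, by positivity, fun w hw k => ?_⟩
    have h1 := hC w hw
    have h2 : a k w ≤ ∑ k, a k w :=
      Finset.single_le_sum (f := fun k => a k w) (fun i _ => ha0 i w) (Finset.mem_univ k)
    have h3 := le_abs_self C
    have h4 := Real.le_norm_self (∑ k, a k w)
    nlinarith [abs_nonneg C]
  set H := ∫ x, hE c Ψ x with hH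
  have hHn : 0 ≤ H := integral_nonneg fun x => hE_nonneg c Ψ x
  set δ := η / (M * H + 1) with hδd
  have hMH : 0 < M * H + 1 := by positivity
  have hδ : 0 < δ := by positivity
  have hδ2 : δ * M * H < η := by
    have : δ * (M * H + 1) = η := div_mul_cancel₀ _ hMH.ne'
    nlinarith
  let P : (Fin (n + 1) → ℝ) → testV m Ω := fun w =>
    ⟨pM Ψ δ fun k => a k w, pM_test hΨ hδ fun k => ha0 k w⟩
  refine negK_contra (BV hΩ hc) (fun v w => ?_) n hNeg (fun w => P w - P (-w)) ?_ ?_ ?_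
  · rw [BV_apply, BV_apply]; simp only [bl_symm c v.1]
  · intro w; simp only [neg_neg, neg_sub]
  · intro Φ
    simp only [map_sub, LinearMap.sub_apply]
    have h1 : Continuous fun w => BV hΩ hc (P w) Φ := pM_bl_cont hΩ hc hΨ hδ ha ha0 Φ.2
    exact h1.sub (h1.comp continuous_neg)
  · intro w hw
    have hw' : -w ∈ {w : Fin (n + 1) → ℝ | ∑ i, |w i| = 1} := by
      simpa using hw
    rw [BV_self]
    have hpt : ∀ x, qd c (P w - P (-w)).1 x ≤
        ∑ k, (a k w + a k (-w)) * qd c (Ψ k) x + δ * M * hE c Ψ x := by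
      intro x
      have e : (P w - P (-w)).1 = (pM Ψ δ fun k => a k w) - pM Ψ δ fun k => a k (-w) := rfl
      rw [e]
      rcases hdis w x with h | h
      · rw [← qd_neg, neg_sub]
        have := qd_mix c hΨ hδ hM (fun k => ha0 k (-w)) (hMb _ hw') (fun k => ha0 k w) x
          (hcoop x) h
        simpa only [add_comm (a _ (-w))] using this
      · exact qd_mix c hΨ hδ hM (fun k => ha0 k w) (hMb _ hw) (fun k => ha0 k (-w)) x
          (hcoop x) h
    have hi1 : Integrable fun x => ∑ k, (a k w + a k (-w)) * qd c (Ψ k) x :=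
      integrable_finsetSum _ fun k _ => (qd_int hΩ hc (hΨ k)).const_mul _
    have hi2 : Integrable fun x => δ * M * hE c Ψ x := (hE_int hΩ hc hΨ).const_mul _
    have := integral_mono (qd_int hΩ hc (P w - P (-w)).2) (hi1.add hi2) hpt
    refine this.trans_lt ?_
    change ∫ x, ((∑ k, (a k w + a k (-w)) * qd c (Ψ k) x) + δ * M * hE c Ψ x) < 0
    rw [integral_add hi1 hi2, integral_const_mul, integral_finsetSum _
      fun k _ => (qd_int hΩ hc (hΨ k)).const_mul _]
    simp only [integral_const_mul]
    have := hF w hw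
    rw [← hH]
    linarith

end Mix2

section Geo

variable {N m : ℕ}

lemma ballAnn_open {Ω : Set (EuclN N)} (h : IsBallOrAnnulus Ω) :
    IsOpen Ω ∧ ∃ R : ℝ, 0 < R ∧ ∀ x ∈ Ω, ‖x‖ ≤ R := by
  rcases h with ⟨R, hR, rfl⟩ | ⟨r, R, hr, hrR, rfl⟩
  · refine ⟨Metric.isOpen_ball, R, hR, fun x hx => ?_⟩
    rw [mem_ball_zero_iff] at hx
    exact hx.le
  · refine ⟨?_, R, hr.trans hrR, fun x hx => hx.2.le⟩
    exact (isOpen_lt continuous_const continuous_norm).inter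
      (isOpen_lt continuous_norm continuous_const)

lemma test_mono {Ω Ω' : Set (EuclN N)} (h : Ω ⊆ Ω') {Ψ : Fin m → EuclN N → ℝ}
    (hΨ : IsTestFun Ω Ψ) : IsTestFun Ω' Ψ :=
  fun i => ⟨(hΨ i).1, (hΨ i).2.1, (hΨ i).2.2.trans h⟩

lemma Qform_eq (f : Fin m → ℝ → (Fin m → ℝ) → ℝ) (U : Fin m → EuclN N → ℝ)
    {Ω : Set (EuclN N)} {Ψ : Fin m → EuclN N → ℝ} (hΨ : IsTestFun Ω Ψ) :
    Qform f U Ω Ψ = ∫ x, qd (fun i j x => pd (f i) j ‖x‖ (fun k => U k x)) Ψ x := by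
  unfold Qform
  exact setIntegral_eq_integral_of_forall_compl_eq_zero
    (f := qd (fun i j x => pd (f i) j ‖x‖ (fun k => U k x)) Ψ)
    fun x hx => qd_zero_of _ fun i hi => hx ((hΨ i).2.2 hi)

lemma pd_cont {f : ℝ → (Fin m → ℝ) → ℝ}
    (hf : ContDiff ℝ 1 (fun q : ℝ × (Fin m → ℝ) => f q.1 q.2)) (j : Fin m) :
    Continuous fun q : ℝ × (Fin m → ℝ) => pd f j q.1 q.2 := by
  have e : (fun q : ℝ × (Fin m → ℝ) => pd f j q.1 q.2) =
      fun q => fderiv ℝ (fun q : ℝ × (Fin m → ℝ) => f q.1 q.2) q (0, Pi.single j 1) := by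
    ext q
    unfold pd
    have h1 := (hf.differentiable (by norm_num) (q.1, q.2)).hasFDerivAt
    have h2 : HasFDerivAt (fun s : Fin m → ℝ => (q.1, s))
        (ContinuousLinearMap.inr ℝ ℝ (Fin m → ℝ)) q.2 := hasFDerivAt_prodMk_right q.1 q.2
    have h3 : HasFDerivAt (f q.1) _ q.2 := h1.comp q.2 h2
    rw [h3.fderiv]
    simp
  rw [e]
  exact (hf.continuous_fderiv (by norm_num)).clm_apply continuous_const

def yy (w : Fin (N + 1) → ℝ) : EuclN N := WithLp.toLp 2 fun i => w i.succ

lemma yy_neg (w : Fin (N + 1) → ℝ) : yy (-w) = - yy w := by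
  ext i; simp [yy]

lemma yy_cont : Continuous (yy (N := N)) := by
  unfold yy
  exact (PiLp.continuous_toLp 2 _).comp (by fun_prop)

noncomputable def aa (R r : ℝ) (e : EuclN N) (w : Fin (N + 1) → ℝ) : ℝ :=
  max 0 (r * ‖yy w‖ + w 0 - R * ‖yy w - ‖yy w‖ • e‖)

lemma aa_cont (R r : ℝ) (e : EuclN N) : Continuous (aa R r e) := by
  have := yy_cont (N := N)
  unfold aa
  fun_prop

lemma aa_pos {R r : ℝ} {e x : EuclN N} {w : Fin (N + 1) → ℝ} (hr : 0 < r)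
    (h : aa R r e w ≠ 0) (hx : ‖x‖ ≤ R) (hxe : 2 * r ≤ ⟪x, e⟫) : 0 < ⟪x, yy w⟫ + w 0 := by
  have h1 : 0 < r * ‖yy w‖ + w 0 - R * ‖yy w - ‖yy w‖ • e‖ := by
    by_contra hcon
    exact h (max_eq_left (not_lt.1 hcon))
  have h2 : ⟪x, yy w⟫ = ‖yy w‖ * ⟪x, e⟫ + ⟪x, yy w - ‖yy w‖ • e⟫ := by
    rw [inner_sub_right, inner_smul_right]; ring
  have h3 : -(R * ‖yy w - ‖yy w‖ • e‖) ≤ ⟪x, yy w - ‖yy w‖ • e⟫ := by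
    have h4 := abs_real_inner_le_norm x (yy w - ‖yy w‖ • e)
    have h5 : ‖x‖ * ‖yy w - ‖yy w‖ • e‖ ≤ R * ‖yy w - ‖yy w‖ • e‖ := by gcongr
    have := neg_abs_le ⟪x, yy w - ‖yy w‖ • e⟫
    linarith
  have h6 : ‖yy w‖ * (2 * r) ≤ ‖yy w‖ * ⟪x, e⟫ := by gcongr
  have h7 : 0 ≤ r * ‖yy w‖ := by positivity
  linarith

lemma aa_cov {R : ℝ} (hR : 0 < R) {ι : Type*} {r : ι → ℝ} {e : ι → EuclN N} (hr : ∀ k, 0 < r k)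
    (hne : Nonempty ι) (hcov : ∀ z : EuclN N, ‖z‖ = 1 → ∃ k, ‖z - e k‖ < r k / R)
    (w : Fin (N + 1) → ℝ) (hw : w ≠ 0) (hw0 : 0 ≤ w 0) : ∃ k, 0 < aa R (r k) (e k) w := by
  by_cases hy : yy w = 0
  · obtain ⟨k⟩ := hne
    refine ⟨k, lt_max_of_lt_right ?_⟩
    have : w 0 ≠ 0 := by
      intro h0
      apply hw
      ext i
      refine Fin.cases h0 (fun l => ?_) i
      have := congrArg (fun v : EuclN N => v l) hy
      simpa [yy] using this
    have : 0 < w 0 := lt_of_le_of_ne hw0 this.symm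
    simpa [hy] using this
  · have hy0 : 0 < ‖yy w‖ := norm_pos_iff.2 hy
    obtain ⟨k, hk⟩ := hcov (‖yy w‖⁻¹ • yy w) (by
      rw [norm_smul, norm_inv, norm_norm, inv_mul_cancel₀ hy0.ne'])
    refine ⟨k, lt_max_of_lt_right ?_⟩
    have e1 : yy w - ‖yy w‖ • e k = ‖yy w‖ • (‖yy w‖⁻¹ • yy w - e k) := by
      rw [smul_sub, smul_smul, mul_inv_cancel₀ hy0.ne', one_smul]
    rw [e1, norm_smul, norm_norm]
    rw [lt_div_iff₀ hR] at hk
    have := mul_lt_mul_of_pos_left hk hy0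
    linarith

end Geo

lemma main_aux
    {N m : ℕ} (hN : 2 ≤ N)
    (Ω : Set (EuclN N)) (hΩ : IsBallOrAnnulus Ω)
    (f : Fin m → ℝ → (Fin m → ℝ) → ℝ)
    (hf : ∀ i, ContDiff ℝ 1 (fun q : ℝ × (Fin m → ℝ) => f i q.1 q.2))
    (U : Fin m → EuclN N → ℝ)
    (hU : ∀ i, ContinuousOn (U i) Ω)
    (hMorse : ¬ NegDefFamily f U Ω (N + 1))
    (hcoup : ∀ e : EuclN N, ‖e‖ = 1 → CoopAlong f (halfDom Ω e)) :
    ∃ e : EuclN N, ‖e‖ = 1 ∧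
      ∀ Ψ : Fin m → EuclN N → ℝ, IsTestFun (halfDom Ω e) Ψ →
        0 ≤ Qform f U (halfDom Ω e) Ψ := by
  by_contra! hcon
  obtain ⟨hO, R, hR, hΩR⟩ := ballAnn_open hΩ
  set c : Fin m → Fin m → EuclN N → ℝ := fun i j x => pd (f i) j ‖x‖ (fun k => U k x) with hcdef
  have hc : ∀ i j, ContinuousOn (c i j) Ω := by
    intro i j
    refine (pd_cont (hf i) j).comp_continuousOn
      (f := fun x : EuclN N => (‖x‖, fun k => U k x)) ?_
    exact continuous_norm.continuousOn.prodMk (continuousOn_pi.2 hU)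
  have hsub : ∀ e, halfDom Ω e ⊆ Ω := fun e x hx => hx.1
  have hex : ∀ e : Metric.sphere (0 : EuclN N) 1, ∃ Ψ : Fin m → EuclN N → ℝ, ∃ r : ℝ,
      IsTestFun (halfDom Ω e) Ψ ∧ ∫ x, qd c Ψ x < 0 ∧ 0 < r ∧
      ∀ i, ∀ x ∈ tsupport (Ψ i), 2 * r ≤ ⟪x, (e : EuclN N)⟫ := by
    intro e
    obtain ⟨Ψ, h1, h2⟩ := hcon e (mem_sphere_zero_iff_norm.1 e.2)
    rw [Qform_eq f U h1] at h2
    obtain ⟨r, hr, hr2⟩ := (supp_compact h1).exists_forall_le'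
      (f := fun x => ⟪x, (e : EuclN N)⟫) (a := 0)
      (continuous_id.inner continuous_const).continuousOn (by
        intro x hx
        obtain ⟨i, hi⟩ := mem_iUnion.1 hx
        exact ((h1 i).2.2 hi).2)
    refine ⟨Ψ, r / 2, h1, h2, by positivity, fun i x hx => ?_⟩
    have := hr2 x (mem_iUnion.2 ⟨i, hx⟩)
    linarith
  choose Ψ r hT hQ hr hrx using hex
  obtain ⟨t, ht⟩ := CompactSpace.elim_nhds_subcover
    (fun e : Metric.sphere (0 : EuclN N) 1 => Metric.ball e (r e / R))
    (fun e => Metric.ball_mem_nhds e (div_pos (hr e) hR))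
  have hcov : ∀ z : EuclN N, ‖z‖ = 1 → ∃ k : t, ‖z - (k.1 : EuclN N)‖ < r k.1 / R := by
    intro z hz
    have : (⟨z, mem_sphere_zero_iff_norm.2 hz⟩ : Metric.sphere (0 : EuclN N) 1) ∈
        ⋃ e ∈ t, Metric.ball e (r e / R) := by rw [ht]; trivial
    simp only [mem_iUnion] at this
    obtain ⟨k, hk, hk2⟩ := this
    refine ⟨⟨k, hk⟩, ?_⟩
    rw [Metric.mem_ball, Subtype.dist_eq, dist_eq_norm] at hk2
    exact hk2
  have hne : Nonempty t := by
    obtain ⟨k, _⟩ := hcov (EuclideanSpace.single ⟨0, by omega⟩ 1) (by simp)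
    exact ⟨k⟩
  have hTΩ : ∀ k : t, IsTestFun Ω (Ψ k.1) := fun k => test_mono (hsub _) (hT k.1)
  have hneg0 : ∀ w : Fin (N + 1) → ℝ, (-w) 0 = - w 0 := fun w => rfl
  refine mix_contra (ι := t) hO hc (Ψ := fun k => Ψ k.1) hTΩ ?_ (fun k => hQ k.1) N
    (a := fun k => aa R (r k.1) k.1) (fun k => aa_cont _ _ _) (fun k w => le_max_left _ _) ?_ ?_ ?_
  · intro x i j hij
    by_cases hx : x ∈ Ω ∧ x ≠ 0
    · left
      have hx0 : 0 < ‖x‖ := norm_pos_iff.2 hx.2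
      refine hcoup (‖x‖⁻¹ • x) (by rw [norm_smul, norm_inv, norm_norm, inv_mul_cancel₀ hx0.ne'])
        i j hij x ⟨hx.1, ?_⟩ _
      rw [inner_smul_right, real_inner_self_eq_norm_sq]
      positivity
    · right
      intro k
      apply image_eq_zero_of_notMem_tsupport
      intro hk
      have := (hT k.1 i).2.2 hk
      refine hx ⟨this.1, ?_⟩
      rintro rfl
      have := this.2
      simp at this
  · intro w x
    by_cases hx : 0 < ⟪x, yy w⟫ + w 0
    · right
      intro k i hk hxk
      have := aa_pos (hr k.1) hk (hΩR x ((hTΩ k i).2.2 hxk)) (hrx k.1 i x hxk)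
      rw [yy_neg, inner_neg_right, hneg0] at this
      linarith
    · left
      intro k i hk hxk
      exact hx (aa_pos (hr k.1) hk (hΩR x ((hTΩ k i).2.2 hxk)) (hrx k.1 i x hxk))
  · intro w hw
    have hw0 : w ≠ 0 := by
      rintro rfl
      simp at hw
    rcases le_total 0 (w 0) with h | h
    · obtain ⟨k, hk⟩ := aa_cov hR (fun k : t => hr k.1) hne hcov w hw0 h
      exact ⟨k, Or.inl hk⟩
    · obtain ⟨k, hk⟩ := aa_cov hR (fun k : t => hr k.1) hne hcov (-w) (neg_ne_zero.2 hw0)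
        (by rw [hneg0]; linarith)
      exact ⟨k, Or.inr hk⟩
  · rintro ⟨v, hv⟩
    apply hMorse
    refine ⟨fun l => (v l).1, fun l => (v l).2, fun d hd => ?_⟩
    have h1 := hv d hd
    rw [BV_self] at h1
    have e : (fun i x => ∑ l, d l * (v l).1 i x) = (∑ l, d l • v l).1 := by
      ext i x
      simp [Finset.sum_apply]
    rw [e, Qform_eq f U (∑ l, d l • v l).2]
    exact h1

/-- **Existence of a half-domain where the linearized quadratic form is nonnegative**,
for solutions of Morse index at most `N`. -/
theorem statement19
    {N m : ℕ} (hN : 2 ≤ N) (hm : 2 ≤ m)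
    (Ω : Set (EuclN N)) (hΩ : IsBallOrAnnulus Ω)
    (f : Fin m → ℝ → (Fin m → ℝ) → ℝ)
    (hf : ∀ i, ContDiff ℝ 1 (fun q : ℝ × (Fin m → ℝ) => f i q.1 q.2))
    (U : Fin m → EuclN N → ℝ)
    (hUreg : ∀ i, ContDiffOn ℝ 2 (U i) Ω ∧ ContinuousOn (U i) (closure Ω))
    (hsol : IsSolution Ω f U)
    (hMorse : ¬ NegDefFamily f U Ω (N + 1))
    (hcoup : ∀ e : EuclN N, ‖e‖ = 1 → FullyCoupledAlong f U (halfDom Ω e)) :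
    ∃ e : EuclN N, ‖e‖ = 1 ∧
      ∀ Ψ : Fin m → EuclN N → ℝ, IsTestFun (halfDom Ω e) Ψ →
        0 ≤ Qform f U (halfDom Ω e) Ψ := by
  exact main_aux hN Ω hΩ f hf U (fun i => (hUreg i).2.mono subset_closure) hMorse
    (fun e he => (hcoup e he).1)
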